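/- There exist absolute constants c, C > 0 with the following property. Let q be a prime power and n ≥ 2 an integer with log q < c·n/(log n)², and let G be any group with SL_n(q) ≤ G ≤ GL_n(q). Choose x, y, z independently and uniformly at random from G. Then with probability at least 1 − e^{−c·n} there exists a word w in the free group F_3 of reduced length at most n^{C·log q} such that w(x, y, z) is a transvection. -/

import Mathlib

/-- An element of a group between `SL_n(q)` and `GL_n(q)` (given as an element of a
subgroup of `GL_n(q)`) is a transvection: its matrix has determinant 1 and
`rank(g - 1) = 1`. -/
def IsTransvection {n : ℕ} {F : Type} [Field F] (g : Matrix (Fin n) (Fin n) F) : Prop :=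
  g.det = 1 ∧ (g - 1).rank = 1

namespace TransvectionWords

open Module
open scoped InnerProductSpace

section Transvections

open LinearEquiv

variable {F V : Type*} [Field F] [AddCommGroup V] [Module F V]

theorem exists_mem_transvections_apply_eq {U : Submodule F V} {x y : V}
    (h : x ∉ U ⊔ Submodule.span F {y - x}) :
    ∃ t ∈ transvections F V, (∀ w ∈ U, t w = w) ∧ t x = y := by
  obtain ⟨f, hfx, hf⟩ := Submodule.exists_le_ker_of_notMem h
  have hU : ∀ w ∈ U, f w = 0 := fun w hw => hf (Submodule.mem_sup_left hw)
  have hyx : f (y - x) = 0 :=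
    hf (Submodule.mem_sup_right (Submodule.mem_span_singleton_self _))
  have hv : ((f x)⁻¹ • f) (y - x) = 0 := by simp [hyx]
  refine ⟨transvection hv, mem_transvections hv, fun w hw => ?_, ?_⟩
  · rw [LinearEquiv.transvection.apply]
    simp [hU w hw]
  · rw [LinearEquiv.transvection.apply]
    simp [inv_mul_cancel₀ hfx]

/-- Two vectors outside a subspace of codimension at least two are exchanged by a product of two
transvections fixing that subspace pointwise. -/
theorem exists_mul_transvections_apply_eq [FiniteDimensional F V] {U : Submodule F V} {x y : V}
    (hx : x ∉ U) (hy : y ∉ U) (hU : finrank F U + 2 ≤ finrank F V) :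
    ∃ t₁ ∈ transvections F V, ∃ t₂ ∈ transvections F V,
      (∀ w ∈ U, (t₁ * t₂) w = w) ∧ (t₁ * t₂) x = y := by
  by_cases h : x ∉ U ⊔ Submodule.span F {y - x}
  · obtain ⟨t, ht, h1, h2⟩ := exists_mem_transvections_apply_eq h
    exact ⟨t, ht, 1, one_mem_transvections, by simpa using h1, by simpa using h2⟩
  push Not at h
  obtain ⟨z, hz⟩ : ∃ z, z ∉ U ⊔ Submodule.span F {x} := by
    by_contra! hall
    have : U ⊔ Submodule.span F {x} = ⊤ := by ext; simp [hall]
    have h1 := Submodule.finrank_add_le_finrank_add_finrank U (Submodule.span F {x})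
    rw [this, finrank_top] at h1
    have := finrank_span_singleton (K := F) (v := x) (by rintro rfl; exact hx U.zero_mem)
    omega
  have hmem : ∀ {a b : V}, a ∈ U ⊔ Submodule.span F {b} ↔ ∃ c : F, a - c • b ∈ U := by
    intro a b
    rw [Submodule.mem_sup]
    constructor
    · rintro ⟨u, hu, w, hw, rfl⟩
      obtain ⟨c, rfl⟩ := Submodule.mem_span_singleton.1 hw
      exact ⟨c, by simpa using hu⟩
    · rintro ⟨c, hc⟩
      exact ⟨_, hc, c • b, Submodule.smul_mem _ _ (Submodule.mem_span_singleton_self _), by simp⟩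
  have hyx : ∃ c : F, y - c • x ∈ U := by
    obtain ⟨c, hc⟩ := hmem.1 h
    have hc0 : c ≠ 0 := by rintro rfl; simp at hc; exact hx hc
    refine ⟨c⁻¹ + 1, ?_⟩
    have := U.smul_mem (-c⁻¹) hc
    convert this using 1
    rw [smul_sub, smul_smul, neg_mul, inv_mul_cancel₀ hc0]
    module
  rw [hmem] at hz
  push Not at hz
  obtain ⟨d, hd⟩ := hyx
  have h1 : x ∉ U ⊔ Submodule.span F {z - x} := by
    rw [hmem]
    rintro ⟨c, hc⟩
    have hc0 : c ≠ 0 := by rintro rfl; simp at hc; exact hx hc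
    refine hz (c⁻¹ + 1) ?_
    have := U.smul_mem (-c⁻¹) hc
    convert this using 1
    rw [smul_sub, smul_smul, neg_mul, inv_mul_cancel₀ hc0]
    module
  have h2 : z ∉ U ⊔ Submodule.span F {y - z} := by
    rw [hmem]
    rintro ⟨c, hc⟩
    by_cases hc1 : 1 + c = 0
    · obtain rfl : c = -1 := by linear_combination hc1
      simp at hc
      exact hy hc
    · refine hz ((1 + c)⁻¹ * (c * d)) ?_
      have := U.smul_mem ((1 + c)⁻¹) (U.add_mem hc (U.smul_mem c hd))
      convert this using 1
      rw [show z - c • (y - z) + c • (y - d • x) = (1 + c) • z - (c * d) • x by module,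
        smul_sub, smul_smul, inv_mul_cancel₀ hc1, one_smul, smul_smul]
  obtain ⟨t₂, ht₂, h21, h22⟩ := exists_mem_transvections_apply_eq h1
  obtain ⟨t₁, ht₁, h11, h12⟩ := exists_mem_transvections_apply_eq h2
  refine ⟨t₁, ht₁, t₂, ht₂, fun w hw => ?_, ?_⟩
  · rw [LinearEquiv.mul_apply, h21 w hw, h11 w hw]
  · rw [LinearEquiv.mul_apply, h22, h12]

theorem det_eq_one_of_mem_transvections {t : V ≃ₗ[F] V} (ht : t ∈ transvections F V) :
    LinearEquiv.det t = 1 := by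
  obtain ⟨f, v, hfv, rfl⟩ := ht
  simp

theorem exists_det_eq_one_apply_eq [FiniteDimensional F V] {U : Submodule F V} {x y : V}
    (hx : x ∉ U) (hy : y ∉ U) (hU : finrank F U + 2 ≤ finrank F V) :
    ∃ t : V ≃ₗ[F] V, LinearEquiv.det t = 1 ∧ (∀ w ∈ U, t w = w) ∧ t x = y := by
  obtain ⟨t₁, ht₁, t₂, ht₂, h1, h2⟩ := exists_mul_transvections_apply_eq hx hy hU
  refine ⟨t₁ * t₂, ?_, h1, h2⟩
  rw [map_mul, det_eq_one_of_mem_transvections ht₁, det_eq_one_of_mem_transvections ht₂, one_mul]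

theorem exists_list_transvections_of_le [FiniteDimensional F V] (k : ℕ) (g : V ≃ₗ[F] V)
    (hg : LinearEquiv.det g = 1) (hk : finrank F V ≤ finrank F g.fixedSubmodule + k) :
    ∃ l : List (V ≃ₗ[F] V), (∀ t ∈ l, t ∈ transvections F V) ∧ l.length ≤ 2 * k ∧ g = l.prod := by
  induction k generalizing g with
  | zero =>
    have : g.fixedSubmodule = ⊤ :=
      Submodule.eq_top_of_finrank_eq (le_antisymm (Submodule.finrank_le _) hk)
    rw [LinearEquiv.fixedSubmodule_eq_top_iff] at this
    exact ⟨[], by simp, by simp, by rw [this]; rfl⟩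
  | succ k ih =>
    by_cases hU : finrank F g.fixedSubmodule + 2 ≤ finrank F V
    · obtain ⟨x, hx⟩ : ∃ x, x ∉ g.fixedSubmodule := by
        by_contra! hall
        have : g.fixedSubmodule = ⊤ := by ext; simp [hall]
        rw [this, finrank_top] at hU
        omega
      have hgx : g x ∉ g.fixedSubmodule := by
        intro h
        apply hx
        rw [LinearMap.mem_fixedSubmodule_iff, LinearEquiv.coe_coe] at h ⊢
        exact g.injective h
      obtain ⟨t₁, ht₁, t₂, ht₂, h1, h2⟩ := exists_mul_transvections_apply_eq hgx hx hU
      obtain ⟨l, hl, hlen, hprod⟩ := ih (t₁ * t₂ * g)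
        (by rw [map_mul, map_mul, det_eq_one_of_mem_transvections ht₁,
              det_eq_one_of_mem_transvections ht₂, hg]; simp) (by
          have hle : g.fixedSubmodule ⊔ Submodule.span F {x} ≤ (t₁ * t₂ * g).fixedSubmodule := by
            refine sup_le (fun w hw => ?_) ?_
            · have hw' := hw
              rw [LinearMap.mem_fixedSubmodule_iff, LinearEquiv.coe_coe] at hw ⊢
              rw [LinearEquiv.mul_apply, hw, h1 w hw']
            · rw [Submodule.span_singleton_le_iff_mem, LinearMap.mem_fixedSubmodule_iff,
                LinearEquiv.coe_coe, LinearEquiv.mul_apply, h2]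
          have h3 := Submodule.finrank_mono hle
          rw [Submodule.finrank_sup_span_singleton hx] at h3
          omega)
      refine ⟨t₂⁻¹ :: t₁⁻¹ :: l, ?_, by simp; omega, ?_⟩
      · intro t ht
        simp only [List.mem_cons] at ht
        rcases ht with rfl | rfl | ht
        · exact inv_mem_transvections_iff.2 ht₂
        · exact inv_mem_transvections_iff.2 ht₁
        · exact hl t ht
      · rw [List.prod_cons, List.prod_cons, ← hprod]
        group
    · have hd : g ∈ dilatransvections F V := by
        rw [mem_dilatransvections_iff_finrank_quotient]
        have := Submodule.finrank_quotient_add_finrank g.fixedSubmodule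
        omega
      obtain ⟨f, v, hfv⟩ := hd
      have hdet : (LinearMap.transvection f v).det = 1 := by
        rw [← hfv, ← LinearEquiv.coe_det, hg, Units.val_one]
      have h0 : f v = 0 := by simpa using hdet
      refine ⟨[g], ?_, by simp; omega, by simp⟩
      simp only [List.mem_singleton, forall_eq]
      refine ⟨f, v, h0, ?_⟩
      apply LinearEquiv.toLinearMap_injective
      rw [hfv, LinearEquiv.transvection.coe_toLinearMap]

theorem exists_list_transvections_prod_eq [FiniteDimensional F V] (g : V ≃ₗ[F] V)
    (hg : LinearEquiv.det g = 1) :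
    ∃ l : List (V ≃ₗ[F] V), (∀ t ∈ l, t ∈ transvections F V) ∧
      l.length ≤ 2 * finrank F V ∧ g = l.prod :=
  exists_list_transvections_of_le _ g hg (by omega)

end Transvections

section SquareZero

variable {F V M : Type*} [Field F] [AddCommGroup V] [Module F V]
  [AddCommGroup M] [Module F M]

/-- `g = 1 + N` with `N² = 0` and `N` of rank `m`. -/
def IsQuadraticUnipotent (m : ℕ) (g : V ≃ₗ[F] V) : Prop :=
  (∀ v, g (g v - v) = g v - v) ∧
    finrank F (LinearMap.range ((g : V →ₗ[F] V) - LinearMap.id)) = m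

theorem isQuadraticUnipotent_of_apply {g : V ≃ₗ[F] V} {i : M →ₗ[F] V} {p : V →ₗ[F] M}
    (hg : ∀ v, g v = v + i (p v)) (hi : Function.Injective i) (hp : Function.Surjective p)
    (hpi : ∀ x, p (i x) = 0) : IsQuadraticUnipotent (finrank F M) g := by
  constructor
  · intro v
    simp [hg, hpi]
  · have : (g : V →ₗ[F] V) - LinearMap.id = i ∘ₗ p := by
      ext v; simp [hg]
    rw [this, LinearMap.range_comp, LinearMap.range_eq_top.2 hp, Submodule.map_top,
      LinearMap.finrank_range_of_inj hi]

variable [FiniteDimensional F V] [FiniteDimensional F M]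

theorem exists_injective_disjoint {K Z : Submodule F V}
    (h : finrank F Z + finrank F M ≤ finrank F K) :
    ∃ i : M →ₗ[F] V, Function.Injective i ∧ LinearMap.range i ≤ K ∧
      Disjoint (LinearMap.range i) Z := by
  obtain ⟨C, hC⟩ := Submodule.exists_isCompl (Z.comap K.subtype)
  have h1 := Submodule.finrank_add_eq_of_isCompl hC
  have h2 : finrank F (Z.comap K.subtype) ≤ finrank F Z := by
    refine LinearMap.finrank_le_finrank_of_injective
      (f := (K.subtype.comp (Z.comap K.subtype).subtype).codRestrict Z fun x => x.2) ?_
    intro x y hxy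
    have h : ((x : K) : V) = ((y : K) : V) := congrArg (fun z : Z => (z : V)) hxy
    exact Subtype.ext (Subtype.ext h)
  obtain ⟨j, hj⟩ : ∃ j : M →ₗ[F] C, Function.Injective j := by
    rw [← lift_rank_le_iff_exists_linearMap, ← finrank_eq_rank, ← finrank_eq_rank]
    rw [Cardinal.lift_natCast, Cardinal.lift_natCast, Nat.cast_le]
    omega
  refine ⟨(K.subtype.comp C.subtype).comp j,
    (K.injective_subtype.comp C.injective_subtype).comp hj, ?_, ?_⟩
  · rintro _ ⟨x, rfl⟩
    exact (j x : K).2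
  · rw [Submodule.disjoint_def]
    rintro _ ⟨x, rfl⟩ hx
    have := (Submodule.disjoint_def.1 hC.disjoint) (j x : K) hx (j x).2
    simp [this]

variable (F V M) in
/-- A pair `M → V → M` consisting of an injection and a surjection whose composite vanishes. -/
structure Frame where
  incl : M →ₗ[F] V
  proj : V →ₗ[F] M
  inj : Function.Injective incl
  surj : Function.Surjective proj
  proj_incl : ∀ x, proj (incl x) = 0

theorem exists_normalForm (φ : Frame F V M) {k : ℕ} (hk : finrank F V = 2 * finrank F M + k) :
    ∃ Φ : (M × M × (Fin k → F)) ≃ₗ[F] V,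
      ∀ a b d, φ.incl (φ.proj (Φ (a, b, d))) = Φ (0, a, 0) := by
  obtain ⟨s, hs⟩ := φ.proj.exists_rightInverse_of_surjective (LinearMap.range_eq_top.2 φ.surj)
  have hs' : ∀ a, φ.proj (s a) = a := fun a => LinearMap.congr_fun hs a
  let T := LinearMap.range (s.coprod φ.incl)
  have hT : finrank F T ≤ 2 * finrank F M := by
    refine (LinearMap.finrank_range_le _).trans ?_
    rw [finrank_prod]; omega
  obtain ⟨δ, hδ, -, hdis⟩ := exists_injective_disjoint (M := Fin k → F)
    (K := (⊤ : Submodule F V)) (Z := T) (by rw [finrank_top, finrank_fin_fun]; omega)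
  let Φ : (M × M × (Fin k → F)) →ₗ[F] V :=
    s.coprod (φ.incl.coprod (δ - s ∘ₗ φ.proj ∘ₗ δ))
  have hΦ : ∀ a b d, Φ (a, b, d) = s a + (φ.incl b + (δ d - s (φ.proj (δ d)))) := by
    intro a b d; rfl
  have hπ : ∀ a b d, φ.proj (Φ (a, b, d)) = a := by
    intro a b d
    rw [hΦ]; simp [hs', φ.proj_incl]
  have hinj : Function.Injective Φ := by
    rw [← LinearMap.ker_eq_bot, LinearMap.ker_eq_bot']
    rintro ⟨a, b, d⟩ h
    have ha : a = 0 := by rw [← hπ a b d, h, map_zero]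
    subst ha
    rw [hΦ, map_zero, zero_add] at h
    have hd : δ d ∈ T := by
      refine ⟨(φ.proj (δ d), -b), ?_⟩
      simp only [LinearMap.coprod_apply, map_neg]
      rw [← sub_eq_zero, ← neg_eq_zero, ← h]
      abel
    have hd0 : δ d = 0 := (Submodule.disjoint_def.1 hdis) _ ⟨d, rfl⟩ hd
    have : d = 0 := hδ (by rw [hd0, map_zero])
    subst this
    have hb : φ.incl b = 0 := by simpa using h
    have : b = 0 := φ.inj (by rw [hb, map_zero])
    subst this
    rfl
  refine ⟨LinearEquiv.ofInjectiveOfFinrankEq Φ hinj ?_, ?_⟩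
  · rw [finrank_prod, finrank_prod, finrank_fin_fun]; omega
  · intro a b d
    change φ.incl (φ.proj (Φ (a, b, d))) = Φ (0, a, 0)
    rw [hπ, hΦ]
    simp

theorem exists_conj_of_frames (φ ψ : Frame F V M) (h : 2 * finrank F M ≤ finrank F V) :
    ∃ e : V ≃ₗ[F] V, ∀ v, e (φ.incl (φ.proj v)) = ψ.incl (ψ.proj (e v)) := by
  obtain ⟨k, hk⟩ := Nat.exists_eq_add_of_le h
  obtain ⟨Φ, hΦ⟩ := exists_normalForm φ hk
  obtain ⟨Ψ, hΨ⟩ := exists_normalForm ψ hk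
  refine ⟨Φ.symm.trans Ψ, fun v => ?_⟩
  obtain ⟨⟨a, b, d⟩, rfl⟩ := Φ.surjective v
  simp [hΦ, hΨ]

theorem IsQuadraticUnipotent.exists_frame {m : ℕ} {g : V ≃ₗ[F] V}
    (hg : IsQuadraticUnipotent m g) (hM : finrank F M = m) :
    ∃ φ : Frame F V M, ∀ v, g v = v + φ.incl (φ.proj v) := by
  let N := (g : V →ₗ[F] V) - LinearMap.id
  let e : LinearMap.range N ≃ₗ[F] M := LinearEquiv.ofFinrankEq _ _ (hg.2.trans hM.symm)
  refine ⟨⟨(LinearMap.range N).subtype ∘ₗ e.symm, e ∘ₗ N.rangeRestrict,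
    (Submodule.injective_subtype _).comp e.symm.injective,
    e.surjective.comp N.surjective_rangeRestrict, ?_⟩, ?_⟩
  · intro x
    obtain ⟨⟨_, v, rfl⟩, rfl⟩ := e.surjective x
    have : N (N v) = 0 := by
      simp only [N, LinearMap.sub_apply, LinearEquiv.coe_coe, LinearMap.id_coe, id_eq]
      rw [hg.1 v, sub_self]
    simp only [LinearMap.coe_comp, Function.comp_apply, LinearEquiv.coe_coe,
      LinearEquiv.symm_apply_apply, Submodule.subtype_apply, EmbeddingLike.map_eq_zero_iff]
    exact Subtype.ext this
  · intro v
    simp [N]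

theorem IsQuadraticUnipotent.isConj {m : ℕ} {g h : V ≃ₗ[F] V} (hg : IsQuadraticUnipotent m g)
    (hh : IsQuadraticUnipotent m h) (hm : 2 * m ≤ finrank F V) :
    ∃ e : V ≃ₗ[F] V, h = e * g * e⁻¹ := by
  obtain ⟨φ, hφ⟩ := hg.exists_frame (M := Fin m → F) (by simp)
  obtain ⟨ψ, hψ⟩ := hh.exists_frame (M := Fin m → F) (by simp)
  obtain ⟨e, he⟩ := exists_conj_of_frames φ ψ (by simpa using hm)
  refine ⟨e, ?_⟩
  rw [eq_mul_inv_iff_mul_eq]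
  ext v
  simp only [LinearEquiv.mul_apply, hφ, hψ, map_add, he]

end SquareZero

section Averages

variable {E Γ L : Type*} [NormedAddCommGroup E] [InnerProductSpace ℝ E] [Group Γ]
  [Fintype L]

/-- The average of the translates of `f` over the image of `σ`. -/
noncomputable def average (ρ : Γ →* (E ≃ₗᵢ[ℝ] E)) (σ : L → Γ) (f : E) : E :=
  (Fintype.card L : ℝ)⁻¹ • ∑ a, ρ (σ a) f

variable (ρ : Γ →* (E ≃ₗᵢ[ℝ] E)) {σ τ : L → Γ} {f : E}

theorem inner_map_map (g h : Γ) (u v : E) : ⟪ρ g u, ρ h v⟫_ℝ = ⟪u, ρ (g⁻¹ * h) v⟫_ℝ := by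
  have : ρ h v = ρ g (ρ (g⁻¹ * h) v) := by
    rw [← Function.comp_apply (f := ρ g), ← LinearIsometryEquiv.coe_mul, ← map_mul,
      mul_inv_cancel_left]
  rw [this, LinearIsometryEquiv.inner_map_map]

theorem map_average_conj (g : Γ) :
    ρ g (average ρ σ f) = (Fintype.card L : ℝ)⁻¹ • ∑ a, ρ (g * σ a) f := by
  simp [average, map_sum, map_mul]

variable [AddCommGroup L]

theorem map_average_eq (hσ : ∀ a b, σ (a + b) = σ a * σ b) (a : L) :
    ρ (σ a) (average ρ σ f) = average ρ σ f := by
  rw [map_average_conj, average]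
  congr 1
  simp only [← hσ]
  exact Equiv.sum_comp (Equiv.addLeft a) fun b => ρ (σ b) f

theorem norm_average_sub_average_le (hσ : ∀ a b, σ (a + b) = σ a * σ b)
    (hτ : ∀ a b, τ (a + b) = τ a * τ b) {κ : ℝ}
    (h₁ : ∀ a, a ≠ 0 → ⟪f, ρ (σ a) f⟫_ℝ = κ) (h₂ : ∀ a, a ≠ 0 → ⟪f, ρ (τ a) f⟫_ℝ = κ)
    (h₁₂ : ∀ a b, (a, b) ≠ 0 → ⟪f, ρ ((σ a)⁻¹ * τ b) f⟫_ℝ = κ) (hL : 1 < Fintype.card L) :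
    ‖average ρ σ f - average ρ τ f‖ ≤ 2 / √(Fintype.card L) * ‖f‖ := by
  classical
  set N : ℝ := (Fintype.card L : ℝ) with hN
  have hN1 : 1 < N := by rw [hN]; exact_mod_cast hL
  have hself : ∀ {σ : L → Γ}, (∀ a b, σ (a + b) = σ a * σ b) →
      (∀ a, a ≠ 0 → ⟪f, ρ (σ a) f⟫_ℝ = κ) →
      ⟪∑ a, ρ (σ a) f, ∑ a, ρ (σ a) f⟫_ℝ = N * (‖f‖ ^ 2 - κ) + N ^ 2 * κ := by
    intro σ hσ h
    have h0 : σ 0 = 1 := by simpa using hσ 0 0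
    have hterm : ∀ a b, ⟪ρ (σ a) f, ρ (σ b) f⟫_ℝ = (if a = b then ‖f‖ ^ 2 - κ else 0) + κ := by
      intro a b
      have : (σ a)⁻¹ * σ b = σ (b - a) := by
        rw [inv_mul_eq_iff_eq_mul, ← hσ]; simp
      rw [inner_map_map, this]
      split_ifs with hab
      · subst hab
        simp [h0]
      · rw [h _ (sub_ne_zero.2 (Ne.symm hab)), zero_add]
    simp_rw [sum_inner, inner_sum, hterm, Finset.sum_add_distrib]
    simp [← hN]
    ring
  have hcross : ⟪∑ a, ρ (σ a) f, ∑ a, ρ (τ a) f⟫_ℝ = (‖f‖ ^ 2 - κ) + N ^ 2 * κ := by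
    have h0 : σ 0 = 1 := by simpa using hσ 0 0
    have h0' : τ 0 = 1 := by simpa using hτ 0 0
    have hterm : ∀ a b, ⟪ρ (σ a) f, ρ (τ b) f⟫_ℝ =
        (if a = 0 then if b = 0 then ‖f‖ ^ 2 - κ else 0 else 0) + κ := by
      intro a b
      rw [inner_map_map]
      by_cases ha : a = 0
      · by_cases hb : b = 0
        · subst ha; subst hb
          simp [h0, h0']
        · rw [h₁₂ a b (by simp [hb])]; simp [hb]
      · rw [h₁₂ a b (by simp [ha])]; simp [ha]
    simp_rw [sum_inner, inner_sum, hterm, Finset.sum_add_distrib]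
    simp [← hN]
    ring
  have hκ : -κ ≤ ‖f‖ ^ 2 := by
    obtain ⟨a, ha⟩ := Fintype.exists_ne_of_one_lt_card hL 0
    rw [← h₁ a ha]
    have := abs_real_inner_le_norm f (ρ (σ a) f)
    rw [LinearIsometryEquiv.norm_map] at this
    nlinarith [neg_abs_le (⟪f, ρ (σ a) f⟫_ℝ)]
  have hsq : ‖average ρ σ f - average ρ τ f‖ ^ 2 ≤ (2 / √N * ‖f‖) ^ 2 := by
    have hnorm : ‖∑ a, ρ (σ a) f - ∑ a, ρ (τ a) f‖ ^ 2 = 2 * (N - 1) * (‖f‖ ^ 2 - κ) := by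
      have e₁ := hself hσ h₁
      have e₂ := hself hτ h₂
      rw [real_inner_self_eq_norm_sq] at e₁ e₂
      rw [@norm_sub_sq_real, hcross, e₁, e₂]
      ring
    rw [average, average, ← smul_sub, norm_smul, mul_pow, hnorm, mul_pow, div_pow,
      Real.sq_sqrt (by positivity), ← hN, Real.norm_eq_abs, sq_abs, inv_pow,
      inv_mul_eq_div]
    rw [div_mul_eq_mul_div, div_le_div_iff₀ (by positivity) (by positivity)]
    have : 2 * (N - 1) * (‖f‖ ^ 2 - κ) ≤ 2 * N * (2 * ‖f‖ ^ 2) := by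
      have h1 : (N - 1) * (‖f‖ ^ 2 - κ) ≤ (N - 1) * (2 * ‖f‖ ^ 2) :=
        mul_le_mul_of_nonneg_left (by linarith) (by linarith)
      nlinarith [sq_nonneg ‖f‖]
    nlinarith [mul_le_mul_of_nonneg_right this (by linarith : (0:ℝ) ≤ N)]
  exact (pow_le_pow_iff_left₀ (norm_nonneg _) (by positivity) two_ne_zero).1 hsq

end Averages

section FrameUnipotents

variable {F V M L : Type*} [Field F] [AddCommGroup V] [Module F V]
  [AddCommGroup M] [Module F M] [Field L] [Module L M]

theorem injective_smul_add_smul {i j : M →ₗ[F] V} (hi : Function.Injective i)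
    (hj : Function.Injective j) (hij : Disjoint (LinearMap.range i) (LinearMap.range j))
    {a b : L} (hab : (a, b) ≠ 0) {x : M} (hx : i (a • x) + j (b • x) = 0) : x = 0 := by
  have h1 : i (a • x) = 0 := by
    refine Submodule.disjoint_def.1 hij _ ⟨_, rfl⟩ ?_
    rw [eq_neg_of_add_eq_zero_left hx, ← map_neg]
    exact ⟨_, rfl⟩
  have h2 : j (b • x) = 0 := by rwa [h1, zero_add] at hx
  have h1' : a • x = 0 := hi (by rw [h1, map_zero])
  have h2' : b • x = 0 := hj (by rw [h2, map_zero])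
  rcases smul_eq_zero.1 h1' with ha | hx
  · rcases smul_eq_zero.1 h2' with hb | hx
    · exact absurd (by rw [ha, hb]; rfl) hab
    · exact hx
  · exact hx

variable [SMulCommClass L F M]

/-- The unipotent map `v ↦ v + incl (a • proj v)`. -/
def Frame.unipotent (φ : Frame F V M) (a : L) : V ≃ₗ[F] V where
  toFun v := v + φ.incl (a • φ.proj v)
  invFun v := v + φ.incl ((-a) • φ.proj v)
  map_add' v w := by simp only [map_add, smul_add]; abel
  map_smul' c v := by simp only [map_smul, smul_add, smul_comm a c (φ.proj v), RingHom.id_apply]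
  left_inv v := by simp [φ.proj_incl]
  right_inv v := by simp [φ.proj_incl]

theorem Frame.unipotent_apply (φ : Frame F V M) (a : L) (v : V) :
    φ.unipotent a v = v + φ.incl (a • φ.proj v) := rfl

theorem Frame.unipotent_add (φ : Frame F V M) (a b : L) :
    φ.unipotent (a + b) = φ.unipotent a * φ.unipotent b := by
  ext v
  simp only [Frame.unipotent_apply, LinearEquiv.mul_apply, map_add, φ.proj_incl, add_zero,
    add_smul, smul_zero, map_zero]
  abel

theorem Frame.unipotent_inv (φ : Frame F V M) (a : L) :
    (φ.unipotent a)⁻¹ = φ.unipotent (-a) := by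
  rw [inv_eq_iff_mul_eq_one, ← φ.unipotent_add]
  ext v
  simp [Frame.unipotent_apply]

/-- Transport of a frame along an automorphism. -/
def Frame.conj (φ : Frame F V M) (e : V ≃ₗ[F] V) : Frame F V M where
  incl := e ∘ₗ φ.incl
  proj := φ.proj ∘ₗ e.symm
  inj := e.injective.comp φ.inj
  surj := φ.surj.comp e.symm.surjective
  proj_incl x := by simp [φ.proj_incl]

theorem Frame.conj_unipotent (φ : Frame F V M) (e : V ≃ₗ[F] V) (a : L) :
    (φ.conj e).unipotent a = e * φ.unipotent a * e⁻¹ := by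
  rw [eq_mul_inv_iff_mul_eq]
  ext v
  simp [Frame.unipotent_apply, Frame.conj]

variable (F M) in
/-- Scalar multiplication by an element of `L` as an `F`-linear map. -/
def scale (a : L) : M →ₗ[F] M where
  toFun x := a • x
  map_add' := smul_add a
  map_smul' c x := smul_comm a c x

theorem scale_apply (a : L) (x : M) : scale F M a x = a • x := rfl

theorem Frame.isQuadraticUnipotent (φ : Frame F V M) {a : L} (ha : a ≠ 0) :
    IsQuadraticUnipotent (finrank F M) (φ.unipotent a) := by
  refine isQuadraticUnipotent_of_apply (i := φ.incl ∘ₗ scale F M a) (p := φ.proj)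
    (fun v => rfl) (φ.inj.comp fun x y h => ?_) φ.surj fun x => φ.proj_incl _
  exact smul_right_injective M ha h

theorem Frame.isQuadraticUnipotent_of_proj_eq {φ ψ : Frame F V M} (h : φ.proj = ψ.proj)
    (hd : Disjoint (LinearMap.range φ.incl) (LinearMap.range ψ.incl)) {a b : L}
    (hab : (a, b) ≠ 0) :
    IsQuadraticUnipotent (finrank F M) ((φ.unipotent a)⁻¹ * ψ.unipotent b) := by
  refine isQuadraticUnipotent_of_apply
    (i := φ.incl ∘ₗ scale F M (-a) + ψ.incl ∘ₗ scale F M b) (p := ψ.proj) (fun v => ?_) ?_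
    ψ.surj fun x => ?_
  · simp only [φ.unipotent_inv, LinearEquiv.mul_apply, Frame.unipotent_apply, h, map_add,
      ψ.proj_incl, LinearMap.add_apply, LinearMap.comp_apply, scale_apply, add_zero, smul_zero,
      map_zero]
    abel
  · rw [← LinearMap.ker_eq_bot, LinearMap.ker_eq_bot']
    intro x hx
    refine injective_smul_add_smul φ.inj ψ.inj hd (a := -a) (b := b) ?_ hx
    contrapose! hab
    simpa using hab
  · simp only [LinearMap.add_apply, LinearMap.comp_apply, map_add, ψ.proj_incl, add_zero]
    rw [← h, φ.proj_incl]

theorem Frame.isQuadraticUnipotent_of_incl_eq {φ ψ : Frame F V M} (h : φ.incl = ψ.incl)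
    (hs : Function.Surjective (φ.proj.prod ψ.proj)) {a b : L} (hab : (a, b) ≠ 0) :
    IsQuadraticUnipotent (finrank F M) ((φ.unipotent a)⁻¹ * ψ.unipotent b) := by
  refine isQuadraticUnipotent_of_apply (i := ψ.incl)
    (p := scale F M (-a) ∘ₗ φ.proj + scale F M b ∘ₗ ψ.proj) (fun v => ?_) ψ.inj
    (fun y => ?_) fun x => ?_
  · rw [φ.unipotent_inv, LinearEquiv.mul_apply, Frame.unipotent_apply, Frame.unipotent_apply,
      map_add, ← h, φ.proj_incl]
    simp only [LinearMap.add_apply, LinearMap.comp_apply, scale_apply, map_add, add_zero]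
    abel
  · by_cases hb : b = 0
    · have ha : -a ≠ 0 := by rintro h0; exact hab (by simp [hb, neg_eq_zero.1 h0])
      obtain ⟨v, hv⟩ := hs ((-a)⁻¹ • y, 0)
      simp only [LinearMap.prod_apply, Function.prod, Prod.mk.injEq] at hv
      refine ⟨v, ?_⟩
      simp only [LinearMap.add_apply, LinearMap.comp_apply, scale_apply, hv, smul_zero, add_zero,
        smul_inv_smul₀ ha]
    · obtain ⟨v, hv⟩ := hs (0, b⁻¹ • y)
      simp only [LinearMap.prod_apply, Function.prod, Prod.mk.injEq] at hv
      refine ⟨v, ?_⟩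
      simp only [LinearMap.add_apply, LinearMap.comp_apply, scale_apply, hv, smul_zero, zero_add,
        smul_inv_smul₀ hb]
  · simp only [LinearMap.add_apply, LinearMap.comp_apply, ψ.proj_incl, map_zero, add_zero]
    rw [← h, φ.proj_incl, map_zero]

theorem exists_proj {i j : M →ₗ[F] V} (hi : Function.Injective i) (hj : Function.Injective j)
    (hij : Disjoint (LinearMap.range i) (LinearMap.range j)) :
    ∃ p : V →ₗ[F] M, (∀ x, p (i x) = 0) ∧ ∀ x, p (j x) = x := by
  have hinj : Function.Injective (i.coprod j) := by
    rw [← LinearMap.ker_eq_bot, LinearMap.ker_eq_bot']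
    rintro ⟨x, y⟩ h
    rw [LinearMap.coprod_apply] at h
    have h1 : i x = 0 := by
      refine Submodule.disjoint_def.1 hij _ ⟨_, rfl⟩ ?_
      rw [eq_neg_of_add_eq_zero_left h, ← map_neg]
      exact ⟨_, rfl⟩
    have h2 : j y = 0 := by rwa [h1, zero_add] at h
    rw [hi (h1.trans i.map_zero.symm), hj (h2.trans j.map_zero.symm)]
    rfl
  obtain ⟨r, hr⟩ := (i.coprod j).exists_leftInverse_of_injective (LinearMap.ker_eq_bot.2 hinj)
  have hr' : ∀ x y, r (i x + j y) = (x, y) := fun x y => LinearMap.congr_fun hr (x, y)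
  refine ⟨LinearMap.snd F M M ∘ₗ r, fun x => ?_, fun x => ?_⟩
  · simpa using congrArg Prod.snd (hr' x 0)
  · simpa using congrArg Prod.snd (hr' 0 x)

variable [FiniteDimensional F V] [FiniteDimensional F M]

theorem exists_frame (h : 2 * finrank F M ≤ finrank F V) : Nonempty (Frame F V M) := by
  obtain ⟨i, hi, -, -⟩ := exists_injective_disjoint (F := F) (V := V) (M := M) (K := ⊤) (Z := ⊥)
    (by rw [finrank_top, finrank_bot]; omega)
  obtain ⟨j, hj, -, hij⟩ := exists_injective_disjoint (M := M) (K := ⊤) (Z := LinearMap.range i)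
    (by rw [finrank_top, LinearMap.finrank_range_of_inj hi]; omega)
  obtain ⟨p, hp, hp'⟩ := exists_proj hi hj hij.symm
  exact ⟨⟨i, p, hi, fun x => ⟨j x, hp' x⟩, hp⟩⟩

variable {E : Type*} [NormedAddCommGroup E] [InnerProductSpace ℝ E] [Fintype L]
  (ρ : (V ≃ₗ[F] V) →* (E ≃ₗᵢ[ℝ] E)) {f : E} {κ : ℝ}

theorem norm_average_sub_average_frame_le (φ ψ : Frame F V M)
    (hκ : ∀ g, IsQuadraticUnipotent (finrank F M) g → ⟪f, ρ g f⟫_ℝ = κ)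
    (h : 5 * finrank F M ≤ finrank F V) :
    ‖average ρ (φ.unipotent (L := L)) f - average ρ (ψ.unipotent (L := L)) f‖ ≤
      8 / √(Fintype.card L) * ‖f‖ := by
  have hL : 1 < Fintype.card L := Fintype.one_lt_card
  have close_of_proj : ∀ φ ψ : Frame F V M, φ.proj = ψ.proj →
      Disjoint (LinearMap.range φ.incl) (LinearMap.range ψ.incl) →
      ‖average ρ (φ.unipotent (L := L)) f - average ρ (ψ.unipotent (L := L)) f‖ ≤
      2 / √(Fintype.card L) * ‖f‖ := fun φ ψ h hd =>
    norm_average_sub_average_le ρ φ.unipotent_add ψ.unipotent_add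
      (fun a ha => hκ _ (φ.isQuadraticUnipotent ha))
      (fun a ha => hκ _ (ψ.isQuadraticUnipotent ha))
      (fun a b hab => hκ _ (Frame.isQuadraticUnipotent_of_proj_eq h hd hab)) hL
  have close_of_incl : ∀ φ ψ : Frame F V M, φ.incl = ψ.incl →
      Function.Surjective (φ.proj.prod ψ.proj) →
      ‖average ρ (φ.unipotent (L := L)) f - average ρ (ψ.unipotent (L := L)) f‖ ≤
      2 / √(Fintype.card L) * ‖f‖ := fun φ ψ h hd =>
    norm_average_sub_average_le ρ φ.unipotent_add ψ.unipotent_add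
      (fun a ha => hκ _ (φ.isQuadraticUnipotent ha))
      (fun a ha => hκ _ (ψ.isQuadraticUnipotent ha))
      (fun a b hab => hκ _ (Frame.isQuadraticUnipotent_of_incl_eq h hd hab)) hL
  obtain ⟨K, hK_eq⟩ : ∃ K, K = LinearMap.ker (φ.proj.prod ψ.proj) := ⟨_, rfl⟩
  have hK : finrank F V ≤ finrank F K + 2 * finrank F M := by
    have h1 := LinearMap.finrank_range_add_finrank_ker (φ.proj.prod ψ.proj)
    have h2 := Submodule.finrank_le (LinearMap.range (φ.proj.prod ψ.proj))
    rw [finrank_prod] at h2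
    rw [hK_eq]
    omega
  have hZ := (Submodule.finrank_add_le_finrank_add_finrank (LinearMap.range φ.incl)
    (LinearMap.range ψ.incl))
  rw [LinearMap.finrank_range_of_inj φ.inj, LinearMap.finrank_range_of_inj ψ.inj] at hZ
  obtain ⟨i, hi, hiK, hid⟩ := exists_injective_disjoint (M := M) (K := K)
    (Z := LinearMap.range φ.incl ⊔ LinearMap.range ψ.incl) (by omega)
  obtain ⟨j, hj, hjK, hjd⟩ := exists_injective_disjoint (M := M) (K := K)
    (Z := LinearMap.range i) (by rw [LinearMap.finrank_range_of_inj hi]; omega)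
  obtain ⟨p, hp, hp'⟩ := exists_proj hi hj hjd.symm
  have hker : ∀ v ∈ K, φ.proj v = 0 ∧ ψ.proj v = 0 := by
    intro v hv
    simpa [hK_eq] using hv
  let φ₁ : Frame F V M := ⟨i, φ.proj, hi, φ.surj, fun x => (hker _ (hiK ⟨x, rfl⟩)).1⟩
  let φ₂ : Frame F V M := ⟨i, p, hi, fun x => ⟨j x, hp' x⟩, hp⟩
  let φ₃ : Frame F V M := ⟨i, ψ.proj, hi, ψ.surj, fun x => (hker _ (hiK ⟨x, rfl⟩)).2⟩
  have c₀ := close_of_proj φ φ₁ rfl ((hid.mono_right le_sup_left).symm)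
  have c₁ := close_of_incl φ₁ φ₂ rfl (by
    rintro ⟨y, y'⟩
    obtain ⟨v, hv⟩ := φ.surj y
    refine ⟨v + j (y' - p v), ?_⟩
    ext
    · simp [φ₁, hv, (hker _ (hjK ⟨y', rfl⟩)).1, (hker _ (hjK ⟨p v, rfl⟩)).1]
    · simp [φ₂, hp'])
  have c₂ := close_of_incl φ₂ φ₃ rfl (by
    rintro ⟨y', y⟩
    obtain ⟨v, hv⟩ := ψ.surj y
    refine ⟨v + j (y' - p v), ?_⟩
    ext
    · simp [φ₂, hp']
    · simp [φ₃, hv, (hker _ (hjK ⟨y', rfl⟩)).2, (hker _ (hjK ⟨p v, rfl⟩)).2])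
  have c₃ := close_of_proj φ₃ ψ rfl (hid.mono_right le_sup_right)
  have t₁ := norm_sub_le_norm_sub_add_norm_sub (average ρ (φ.unipotent (L := L)) f)
    (average ρ (φ₁.unipotent (L := L)) f) (average ρ (ψ.unipotent (L := L)) f)
  have t₂ := norm_sub_le_norm_sub_add_norm_sub (average ρ (φ₁.unipotent (L := L)) f)
    (average ρ (φ₂.unipotent (L := L)) f) (average ρ (ψ.unipotent (L := L)) f)
  have t₃ := norm_sub_le_norm_sub_add_norm_sub (average ρ (φ₂.unipotent (L := L)) f)
    (average ρ (φ₃.unipotent (L := L)) f) (average ρ (ψ.unipotent (L := L)) f)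
  have : 8 / √(Fintype.card L) * ‖f‖ = 4 * (2 / √(Fintype.card L) * ‖f‖) := by ring
  linarith

end FrameUnipotents

section Invariance

variable {F V M L : Type*} [Field F] [AddCommGroup V] [Module F V]
  [AddCommGroup M] [Module F M] [Field L] [Module L M] [SMulCommClass L F M]
  [FiniteDimensional F V] [FiniteDimensional F M]

variable (M) in
theorem exists_mul_eq_of_mem_transvections (hM : 0 < finrank F M)
    (h : 2 * finrank F M < finrank F V) {t : V ≃ₗ[F] V} (ht : t ∈ LinearEquiv.transvections F V)
    (ht1 : t ≠ 1) :
    ∃ g₁ g₂ : V ≃ₗ[F] V, IsQuadraticUnipotent (finrank F M) g₁ ∧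
      IsQuadraticUnipotent (finrank F M) g₂ ∧ t = g₁ * g₂ := by
  obtain ⟨θ, w, hθ, rfl⟩ := ht
  have apply_eq : ∀ v, LinearEquiv.transvection hθ v = v + θ v • w := fun v => by
    rw [LinearEquiv.transvection.apply]
  have hw : w ≠ 0 := by
    rintro rfl
    exact ht1 (by ext v; simp)
  have hθ0 : θ ≠ 0 := by
    rintro rfl
    exact ht1 (by ext v; simp)
  obtain ⟨φ⟩ := exists_frame (F := F) (V := V) (M := M) h.le
  obtain ⟨e, he, heφ⟩ : ∃ e, φ.proj e = 0 ∧ e ∉ LinearMap.range φ.incl := by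
    by_contra! hall
    have h1 : finrank F (LinearMap.ker φ.proj) ≤ finrank F (LinearMap.range φ.incl) :=
      Submodule.finrank_mono fun v hv => hall v hv
    have h2 := LinearMap.finrank_range_add_finrank_ker φ.proj
    rw [LinearMap.finrank_range_of_inj φ.inj] at h1
    rw [LinearMap.range_eq_top.2 φ.surj, finrank_top] at h2
    omega
  have he0 : e ≠ 0 := by rintro rfl; exact heφ (Submodule.zero_mem _)
  obtain ⟨x₀, hx₀⟩ := finrank_pos_iff_exists_ne_zero.1 hM
  obtain ⟨c, hc⟩ := Projective.exists_dual_ne_zero F hx₀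
  have hc0 : c ≠ 0 := by rintro rfl; exact hc rfl
  let ψ : Frame F V M := ⟨φ.incl + c.smulRight e, φ.proj, by
    rw [← LinearMap.ker_eq_bot, LinearMap.ker_eq_bot']
    intro x hx
    rw [LinearMap.add_apply, LinearMap.smulRight_apply] at hx
    by_cases hcx : c x = 0
    · rw [hcx, zero_smul, add_zero] at hx
      exact φ.inj (by rw [hx, map_zero])
    · refine absurd ⟨-(c x)⁻¹ • x, ?_⟩ heφ
      rw [map_smul, eq_neg_of_add_eq_zero_left hx, neg_smul_neg, inv_smul_smul₀ hcx], φ.surj,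
    fun x => by simp [φ.proj_incl, he]⟩
  have hmul : ∀ v, (ψ.unipotent (1 : F) * φ.unipotent (-1 : F)) v = v + c (φ.proj v) • e := by
    intro v
    simp only [LinearEquiv.mul_apply, Frame.unipotent_apply, ψ, map_add, neg_smul, one_smul,
      map_neg, φ.proj_incl, LinearMap.add_apply, LinearMap.smulRight_apply, add_zero, map_zero]
    abel
  have q₁ : IsQuadraticUnipotent (finrank F F) (LinearEquiv.transvection hθ) :=
    isQuadraticUnipotent_of_apply (i := LinearMap.toSpanSingleton F V w) (p := θ)
      (fun v => by simp [apply_eq]) (LinearMap.ker_eq_bot.1 (LinearMap.ker_toSpanSingleton F hw))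
      (LinearMap.surjective hθ0) (fun x => by simp [hθ])
  have q₂ : IsQuadraticUnipotent (finrank F F) (ψ.unipotent (1 : F) * φ.unipotent (-1 : F)) :=
    isQuadraticUnipotent_of_apply (i := LinearMap.toSpanSingleton F V e) (p := c ∘ₗ φ.proj)
      (fun v => by simp [hmul]) (LinearMap.ker_eq_bot.1 (LinearMap.ker_toSpanSingleton F he0))
      ((LinearMap.surjective hc0).comp φ.surj) (fun x => by simp [he])
  obtain ⟨a, ha⟩ := q₂.isConj q₁ (by rw [finrank_self]; omega)
  refine ⟨(ψ.conj a).unipotent (1 : F), (φ.conj a).unipotent (-1 : F),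
    Frame.isQuadraticUnipotent _ one_ne_zero,
    Frame.isQuadraticUnipotent _ (neg_ne_zero.2 one_ne_zero), ?_⟩
  rw [ha, Frame.conj_unipotent, Frame.conj_unipotent]
  group

variable {E : Type*} [NormedAddCommGroup E] [InnerProductSpace ℝ E] [Fintype L]
  (ρ : (V ≃ₗ[F] V) →* (E ≃ₗᵢ[ℝ] E)) {f : E} {κ : ℝ}

theorem norm_map_mul_sub_le {Γ : Type*} [Group Γ] (ρ : Γ →* (E ≃ₗᵢ[ℝ] E)) {g h : Γ} {v : E}
    {a b : ℝ} (hg : ‖ρ g v - v‖ ≤ a) (hh : ‖ρ h v - v‖ ≤ b) : ‖ρ (g * h) v - v‖ ≤ a + b := by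
  have e : ρ (g * h) v = ρ g (ρ h v) := by rw [map_mul]; rfl
  have h1 : ‖ρ g (ρ h v) - ρ g v‖ ≤ b := by
    rw [← map_sub, LinearIsometryEquiv.norm_map]; exact hh
  have := norm_sub_le_norm_sub_add_norm_sub (ρ g (ρ h v)) (ρ g v) v
  rw [e]
  linarith

theorem norm_average_frame_le {S : Finset (V ≃ₗ[F] V)} (hS : ∀ s ∈ S, LinearEquiv.det s = 1)
    (hne : S.Nonempty) (φ : Frame F V M)
    (hκ : ∀ g, IsQuadraticUnipotent (finrank F M) g → ⟪f, ρ g f⟫_ℝ = κ)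
    (hM : 0 < finrank F M) (h : 5 * finrank F M ≤ finrank F V)
    (hf : ∀ g, ∑ s ∈ S, ρ (s * g) f = 0) :
    ‖average ρ (φ.unipotent (L := L)) f‖ ≤ 64 * finrank F V / √(Fintype.card L) * ‖f‖ := by
  set v := average ρ (φ.unipotent (L := L)) f with hv
  set η := 8 / √(Fintype.card L) * ‖f‖ with hη
  have hη0 : 0 ≤ η := by positivity
  have hquad : ∀ g, IsQuadraticUnipotent (finrank F M) g → ‖ρ g v - v‖ ≤ 2 * η := by
    intro g hg
    obtain ⟨ψ, hψ⟩ := hg.exists_frame (M := M) rfl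
    have hgψ : g = ψ.unipotent (1 : L) := by
      ext v; rw [hψ, Frame.unipotent_apply, one_smul]
    have hfix := map_average_eq ρ (f := f) (ψ.unipotent_add (L := L)) 1
    rw [← hgψ] at hfix
    have hd := norm_average_sub_average_frame_le (L := L) ρ φ ψ hκ h
    have h1 : ‖ρ g v - ρ g (average ρ (ψ.unipotent (L := L)) f)‖ ≤ η := by
      rw [← map_sub, LinearIsometryEquiv.norm_map]; exact hd
    rw [hfix] at h1
    have := norm_sub_le_norm_sub_add_norm_sub (ρ g v) (average ρ (ψ.unipotent (L := L)) f) v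
    rw [norm_sub_rev (average ρ (ψ.unipotent (L := L)) f) v] at this
    linarith
  have htrans : ∀ t ∈ LinearEquiv.transvections F V, ‖ρ t v - v‖ ≤ 4 * η := by
    intro t ht
    by_cases h1 : t = 1
    · rw [h1, map_one, LinearIsometryEquiv.coe_one, id, sub_self, norm_zero]; positivity
    obtain ⟨g₁, g₂, hg₁, hg₂, rfl⟩ := exists_mul_eq_of_mem_transvections M hM (by omega) ht h1
    exact (norm_map_mul_sub_le ρ (hquad _ hg₁) (hquad _ hg₂)).trans (by linarith)
  have hlist : ∀ l : List (V ≃ₗ[F] V), (∀ t ∈ l, t ∈ LinearEquiv.transvections F V) →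
      ‖ρ l.prod v - v‖ ≤ l.length * (4 * η) := by
    intro l
    induction l with
    | nil => simp
    | cons t l ih =>
      intro hl
      rw [List.prod_cons, List.length_cons]
      refine (norm_map_mul_sub_le ρ (htrans t (hl t (by simp)))
        (ih fun s hs => hl s (by simp [hs]))).trans (le_of_eq ?_)
      push_cast; ring
  have hdet : ∀ s : V ≃ₗ[F] V, LinearEquiv.det s = 1 →
      ‖ρ s v - v‖ ≤ 64 * finrank F V / √(Fintype.card L) * ‖f‖ := by
    intro s hs
    obtain ⟨l, hl, hlen, rfl⟩ := exists_list_transvections_prod_eq s hs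
    refine (hlist l hl).trans ?_
    have : (l.length : ℝ) ≤ 2 * finrank F V := by exact_mod_cast hlen
    calc (l.length : ℝ) * (4 * η) ≤ 2 * finrank F V * (4 * η) := by gcongr
      _ = _ := by rw [hη]; ring
  have hsum : ∑ s ∈ S, ρ s v = 0 := by
    simp only [hv, map_average_conj, ← Finset.smul_sum]
    rw [Finset.sum_comm]
    simp only [hf, Finset.sum_const_zero, smul_zero]
  have hSpos : (0 : ℝ) < S.card := by
    exact_mod_cast Finset.card_pos.2 hne
  have hcard : (S.card : ℝ) * ‖v‖ = ‖∑ s ∈ S, (ρ s v - v)‖ := by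
    rw [Finset.sum_sub_distrib, hsum, zero_sub, norm_neg, Finset.sum_const,
      ← Nat.cast_smul_eq_nsmul ℝ, norm_smul, Real.norm_natCast]
  have hle : ‖∑ s ∈ S, (ρ s v - v)‖ ≤
      S.card * (64 * finrank F V / √(Fintype.card L) * ‖f‖) := by
    rw [← nsmul_eq_mul]
    refine norm_sum_le_of_le _ (fun s hs => hdet s (hS s hs)) |>.trans ?_
    rw [Finset.sum_const]
  rw [← hcard] at hle
  exact le_of_mul_le_mul_left hle hSpos

end Invariance

section Commutator

variable {F V L : Type*} [Field F] [AddCommGroup V] [Module F V] [Field L] [Algebra F L]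
  [FiniteDimensional F V] [FiniteDimensional F L] [Fintype L]
  {E : Type*} [NormedAddCommGroup E] [InnerProductSpace ℝ E]
  (ρ : (V ≃ₗ[F] V) →* (E ≃ₗᵢ[ℝ] E)) {f : E}

theorem abs_inner_le_of_frame {S : Finset (V ≃ₗ[F] V)} (hS : ∀ s ∈ S, LinearEquiv.det s = 1)
    (hne : S.Nonempty) (hf : ∀ g, ∑ s ∈ S, ρ (s * g) f = 0)
    (hclass : ∀ g h, ⟪f, ρ (h * g * h⁻¹) f⟫_ℝ = ⟪f, ρ g f⟫_ℝ)
    (h : 10 * finrank F L ≤ finrank F V) {u : V ≃ₗ[F] V} {i : L →ₗ[F] V} {p : V →ₗ[F] L}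
    (hi : ∀ x y, u.symm (i x) + i y = 0 → x = 0 ∧ y = 0)
    (hp : Function.Surjective ((p ∘ₗ (u : V →ₗ[F] V)).prod p))
    (h₀ : ∀ x, p (i x) = 0) (h₁ : ∀ x, p (u (i x)) = 0) (h₂ : ∀ x, p (u.symm (i x)) = 0) :
    |⟪f, ρ u f⟫_ℝ| ≤ 64 * finrank F V / √(Fintype.card L) * ‖f‖ ^ 2 := by
  let σ : Frame F V L := ⟨i, p, by
    rw [← LinearMap.ker_eq_bot, LinearMap.ker_eq_bot']
    intro x hx
    exact (hi 0 x (by simp [hx])).2, fun x => by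
      obtain ⟨v, hv⟩ := hp (0, x)
      exact ⟨v, by simpa using congrArg Prod.snd hv⟩, h₀⟩
  let φ : Frame F V (L × L) := ⟨((u.symm : V →ₗ[F] V) ∘ₗ i).coprod (-i),
    (p ∘ₗ (u : V →ₗ[F] V)).prod p, by
      rw [← LinearMap.ker_eq_bot, LinearMap.ker_eq_bot']
      rintro ⟨x, y⟩ hxy
      have := hi x (-y) (by simpa using hxy)
      simpa using this, hp, fun ⟨x, y⟩ => by simp [h₀, h₁, h₂]⟩
  have hcomm : ∀ a : L, σ.unipotent a * u * (σ.unipotent a)⁻¹ = u * φ.unipotent a := by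
    intro a
    rw [mul_inv_eq_iff_eq_mul]
    ext v
    simp only [LinearEquiv.mul_apply, Frame.unipotent_apply, σ, φ, LinearMap.coprod_apply,
      LinearMap.prod_apply, Function.prod, LinearMap.comp_apply, LinearEquiv.coe_coe, map_add,
      Prod.smul_fst, Prod.smul_snd, LinearMap.neg_apply, map_neg, LinearEquiv.apply_symm_apply,
      h₀, h₁, add_zero, smul_zero, map_zero]
    abel
  have hrank : finrank F (L × L) = 2 * finrank F L := by rw [finrank_prod]; omega
  have hLpos : 0 < finrank F L := finrank_pos
  have hκ : ∀ g, IsQuadraticUnipotent (finrank F (L × L)) g →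
      ⟪f, ρ g f⟫_ℝ = ⟪f, ρ (φ.unipotent (1 : L)) f⟫_ℝ := by
    intro g hg
    obtain ⟨e, he⟩ := (φ.isQuadraticUnipotent (one_ne_zero (α := L))).isConj hg (by omega)
    rw [he, hclass]
  have hnorm := norm_average_frame_le (L := L) ρ hS hne φ hκ (by omega) (by omega) hf
  have hN : (Fintype.card L : ℝ) ≠ 0 := by simp
  have hinner : ⟪f, ρ u (average ρ (φ.unipotent (L := L)) f)⟫_ℝ = ⟪f, ρ u f⟫_ℝ := by
    rw [map_average_conj, inner_smul_right, inner_sum]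
    simp only [← hcomm, hclass]
    rw [Finset.sum_const, Finset.card_univ, nsmul_eq_mul, inv_mul_cancel_left₀ hN]
  rw [← hinner]
  refine (abs_real_inner_le_norm _ _).trans ?_
  rw [LinearIsometryEquiv.norm_map]
  calc _ ≤ ‖f‖ * (64 * finrank F V / √(Fintype.card L) * ‖f‖) := by gcongr
    _ = _ := by ring

end Commutator

section Generic

variable {F W : Type*} [Field F] [AddCommGroup W] [Module F W] [FiniteDimensional F W]

theorem finrank_comap_le (f : W →ₗ[F] W) (Y : Submodule F W) :
    finrank F (Y.comap f) ≤ finrank F (LinearMap.ker f) + finrank F Y := by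
  have h := LinearMap.finrank_range_add_finrank_ker
    (f.restrict (p := Y.comap f) (q := Y) fun x hx => hx)
  have h1 : finrank F (LinearMap.ker (f.restrict (p := Y.comap f) (q := Y) fun x hx => hx)) ≤
      finrank F (LinearMap.ker f) := by
    rw [LinearMap.ker_restrict, ← LinearMap.finrank_range_of_inj
      (f := (Submodule.subtype _).comp (Submodule.subtype _)) ?_]
    · refine Submodule.finrank_mono ?_
      rintro _ ⟨x, rfl⟩
      exact LinearMap.mem_ker.1 x.2
    · exact (Submodule.injective_subtype _).comp (Submodule.injective_subtype _)
  have h2 := Submodule.finrank_le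
    (LinearMap.range (f.restrict (p := Y.comap f) (q := Y) fun x hx => hx))
  omega

variable [Fintype F]

theorem exists_mem_forall_notMem {T : W →ₗ[F] W} {K Y : Submodule F W} {e : ℕ}
    (hT : ∀ α : F, finrank F (LinearMap.ker (T - α • LinearMap.id)) ≤ e)
    (hK : e + finrank F Y + 2 ≤ finrank F K) :
    ∃ x ∈ K, x ∉ Y ∧ ∀ α : F, T x - α • x ∉ Y := by
  classical
  by_contra! hall
  have : Finite W := Module.finite_of_finite F
  have : Fintype W := Fintype.ofFinite W
  let S : Option F → Submodule F W := fun o => o.elim Y fun α => Y.comap (T - α • LinearMap.id)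
  have hS : ∀ o, finrank F (S o) ≤ e + finrank F Y := by
    rintro (_ | α)
    · exact Nat.le_add_left _ _
    · exact (finrank_comap_le _ _).trans (Nat.add_le_add_right (hT α) _)
  have hcard : ∀ X : Submodule F W, (Finset.univ.filter (· ∈ X)).card =
      Fintype.card F ^ finrank F X := fun X => by
    rw [← Module.card_eq_pow_finrank (K := F), Fintype.card_subtype]
  have hsub : Finset.univ.filter (· ∈ K) ⊆
      Finset.univ.biUnion fun o => Finset.univ.filter (· ∈ S o) := by
    intro x hx
    simp only [Finset.mem_filter, Finset.mem_univ, true_and] at hx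
    simp only [Finset.mem_biUnion, Finset.mem_univ, true_and, Finset.mem_filter]
    by_cases hxY : x ∈ Y
    · exact ⟨none, hxY⟩
    · obtain ⟨α, hα⟩ := hall x hx hxY
      exact ⟨some α, by simpa [S] using hα⟩
  have hq : 1 < Fintype.card F := Fintype.one_lt_card
  have h1 := (Finset.card_le_card hsub).trans Finset.card_biUnion_le
  simp only [hcard] at h1
  have h2 : ∑ o : Option F, Fintype.card F ^ finrank F (S o) ≤
      (Fintype.card F + 1) * Fintype.card F ^ (e + finrank F Y) := by
    refine (Finset.sum_le_card_nsmul _ _ _ fun o _ => Nat.pow_le_pow_right hq.le (hS o)).trans ?_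
    rw [Finset.card_univ, Fintype.card_option, smul_eq_mul]
  have h3 : Fintype.card F ^ (e + finrank F Y + 2) ≤ Fintype.card F ^ finrank F K :=
    Nat.pow_le_pow_right hq.le hK
  have h4 : 0 < Fintype.card F ^ (e + finrank F Y) := by positivity
  have h5 : Fintype.card F + 1 < Fintype.card F ^ 2 := by nlinarith
  have h6 := Nat.mul_lt_mul_of_pos_right h5 h4
  rw [pow_add _ _ 2, mul_comm] at h3
  omega

theorem exists_independent_pairs {T : W →ₗ[F] W} {K : Submodule F W} {e : ℕ} (b : ℕ)
    (hT : ∀ α : F, finrank F (LinearMap.ker (T - α • LinearMap.id)) ≤ e)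
    (hK : e + 2 * b ≤ finrank F K) :
    ∃ x : Fin b → W, (∀ i, x i ∈ K) ∧
      ∀ c d : Fin b → F, ∑ i, c i • T (x i) + ∑ i, d i • x i = 0 → c = 0 ∧ d = 0 := by
  induction b with
  | zero => exact ⟨Fin.elim0, fun i => i.elim0, fun c d _ => ⟨Subsingleton.elim _ _,
      Subsingleton.elim _ _⟩⟩
  | succ b ih =>
    obtain ⟨x, hxK, hx⟩ := ih (by omega)
    let Y := Submodule.span F (Set.range (Sum.elim (fun i => T (x i)) x))
    have hY : finrank F Y ≤ 2 * b := by
      refine (finrank_range_le_card _).trans ?_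
      simp; omega
    have hmem : ∀ c d : Fin b → F, ∑ i, c i • T (x i) + ∑ i, d i • x i ∈ Y := fun c d =>
      Y.add_mem (Y.sum_mem fun i _ => Y.smul_mem _ (Submodule.subset_span ⟨Sum.inl i, rfl⟩))
        (Y.sum_mem fun i _ => Y.smul_mem _ (Submodule.subset_span ⟨Sum.inr i, rfl⟩))
    obtain ⟨y, hyK, hy, hyT⟩ := exists_mem_forall_notMem (K := K) (Y := Y) hT (by omega)
    refine ⟨Fin.cons y x, Fin.cases (by simpa using hyK) (by simpa using hxK), fun c d hcd => ?_⟩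
    simp only [Fin.sum_univ_succ, Fin.cons_zero, Fin.cons_succ] at hcd
    have hm := hmem (fun i => c i.succ) (fun i => d i.succ)
    have hy0 : c 0 • T y + d 0 • y ∈ Y := by
      have : c 0 • T y + d 0 • y =
          -(∑ i : Fin b, c i.succ • T (x i) + ∑ i : Fin b, d i.succ • x i) := by
        rw [← sub_eq_zero, ← hcd]; abel
      rw [this]
      exact Y.neg_mem hm
    have hc : c 0 = 0 := by
      by_contra hc
      refine hyT (-(c 0)⁻¹ * d 0) ?_
      have := Y.smul_mem (c 0)⁻¹ hy0
      rw [smul_add, inv_smul_smul₀ hc] at this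
      convert this using 1
      module
    rw [hc, zero_smul, zero_add] at hy0
    have hd : d 0 = 0 := by
      by_contra hd
      exact hy ((Y.smul_mem_iff hd).1 hy0)
    simp only [hc, hd, zero_smul, zero_add] at hcd
    obtain ⟨h1, h2⟩ := hx _ _ hcd
    exact ⟨funext (Fin.cases hc fun i => congrFun h1 i),
      funext (Fin.cases hd fun i => congrFun h2 i)⟩

end Generic

section Spectral

variable {F V L : Type*} [Field F] [Fintype F] [AddCommGroup V] [Module F V]
  [FiniteDimensional F V] [Field L] [Algebra F L] [FiniteDimensional F L]

theorem exists_incl_proj {u : V ≃ₗ[F] V} {e : ℕ}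
    (hu : ∀ α : F, finrank F (LinearMap.ker ((u : V →ₗ[F] V) - α • LinearMap.id)) ≤ e)
    (h : e + 5 * finrank F L ≤ finrank F V) :
    ∃ (i : L →ₗ[F] V) (p : V →ₗ[F] L), (∀ x y, u.symm (i x) + i y = 0 → x = 0 ∧ y = 0) ∧
      Function.Surjective ((p ∘ₗ (u : V →ₗ[F] V)).prod p) ∧
      (∀ x, p (i x) = 0) ∧ (∀ x, p (u (i x)) = 0) ∧ ∀ x, p (u.symm (i x)) = 0 := by
  have husymm : ∀ α : F,
      finrank F (LinearMap.ker ((u.symm : V →ₗ[F] V) - α • LinearMap.id)) ≤ e := by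
    intro α
    refine le_trans (Submodule.finrank_mono ?_) (hu α⁻¹)
    intro v hv
    simp only [LinearMap.mem_ker, LinearMap.sub_apply, LinearEquiv.coe_coe, LinearMap.smul_apply,
      LinearMap.id_apply, sub_eq_zero] at hv ⊢
    have hv' : v = α • u v := by
      have := congrArg u hv
      simpa using this
    by_cases hα : α = 0
    · have : v = 0 := by rw [hv', hα, zero_smul]
      simp [this]
    · conv_rhs => rw [hv']
      rw [inv_smul_smul₀ hα]
  obtain ⟨x, -, hx⟩ := exists_independent_pairs (K := ⊤) (finrank F L) husymm
    (by rw [finrank_top]; omega)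
  have hudual : ∀ α : F, finrank F (LinearMap.ker ((u : V →ₗ[F] V).dualMap -
      α • LinearMap.id)) ≤ e := by
    intro α
    have e1 : (u : V →ₗ[F] V).dualMap - α • LinearMap.id =
        ((u : V →ₗ[F] V) - α • LinearMap.id).dualMap := by
      ext θ v; simp
    have h1 := LinearMap.finrank_range_add_finrank_ker
      ((u : V →ₗ[F] V) - α • LinearMap.id).dualMap
    have h2 := LinearMap.finrank_range_add_finrank_ker ((u : V →ₗ[F] V) - α • LinearMap.id)
    rw [LinearMap.finrank_range_dualMap_eq_finrank_range, Subspace.dual_finrank_eq] at h1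
    have := hu α
    rw [e1]
    omega
  let X : Submodule F V := Submodule.span F
    (Set.range (Sum.elim x (Sum.elim (fun i => u (x i)) fun i => u.symm (x i))))
  have hX : finrank F X ≤ 3 * finrank F L := by
    refine (finrank_range_le_card _).trans ?_
    simp; omega
  have hXK := Subspace.finrank_add_finrank_dualAnnihilator_eq X
  obtain ⟨θ, hθX, hθ⟩ := exists_independent_pairs (K := X.dualAnnihilator) (finrank F L) hudual
    (by omega)
  simp only [Submodule.mem_dualAnnihilator] at hθX
  have hθ1 : ∀ i j, θ j (x i) = 0 := fun i j => hθX j _ (Submodule.subset_span ⟨Sum.inl i, rfl⟩)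
  have hθ2 : ∀ i j, θ j (u (x i)) = 0 := fun i j =>
    hθX j _ (Submodule.subset_span ⟨Sum.inr (Sum.inl i), rfl⟩)
  have hθ3 : ∀ i j, θ j (u.symm (x i)) = 0 := fun i j =>
    hθX j _ (Submodule.subset_span ⟨Sum.inr (Sum.inr i), rfl⟩)
  let B := finBasis F L
  let i : L →ₗ[F] V := B.constr F x
  let p : V →ₗ[F] L := B.equivFun.symm.toLinearMap ∘ₗ LinearMap.pi θ
  have hi : ∀ y, i y = ∑ k, B.equivFun y k • x k := fun y => by
    simp [i, Basis.constr_apply_fintype]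
  have hp : ∀ v, (∀ j, θ j v = 0) → p v = 0 := fun v hv => by
    have : LinearMap.pi θ v = 0 := funext hv
    simp only [p, LinearMap.comp_apply, this, map_zero]
  refine ⟨i, p, fun y z hyz => ?_, ?_, fun y => hp _ fun j => ?_, fun y => hp _ fun j => ?_,
    fun y => hp _ fun j => ?_⟩
  · simp only [hi, map_sum, map_smul] at hyz
    obtain ⟨h1, h2⟩ := hx _ _ hyz
    exact ⟨by simpa using h1, by simpa using h2⟩
  · rw [← LinearMap.dualMap_injective_iff, ← LinearMap.ker_eq_bot, LinearMap.ker_eq_bot']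
    intro θ' hθ'
    let c : Fin (finrank F L) → F := fun k => θ' (B k, 0)
    let d : Fin (finrank F L) → F := fun k => θ' (0, B k)
    have hcd : ∀ y z : L, θ' (y, z) = ∑ k, B.equivFun y k * c k + ∑ k, B.equivFun z k * d k := by
      intro y z
      have hy : (y, z) = (∑ k, B.equivFun y k • (B k, (0 : L))) +
          ∑ k, B.equivFun z k • ((0 : L), B k) := by
        ext
        · simp [Prod.fst_sum, B.sum_repr]
        · simp [Prod.snd_sum, B.sum_repr]
      rw [hy, map_add, map_sum, map_sum]
      simp only [map_smul, smul_eq_mul, c, d]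
    have hBp : ∀ v k, B.equivFun (p v) k = θ k v := fun v k => by
      change B.equivFun (B.equivFun.symm (LinearMap.pi θ v)) k = _
      rw [LinearEquiv.apply_symm_apply]
      rfl
    obtain ⟨hc, hd⟩ := hθ c d (by
      ext v
      have hv := LinearMap.congr_fun hθ' v
      rw [LinearMap.dualMap_apply, LinearMap.zero_apply] at hv
      change θ' (p (u v), p v) = 0 at hv
      rw [hcd] at hv
      simp only [hBp] at hv
      simpa [LinearMap.sum_apply, mul_comm] using hv)
    refine LinearMap.ext fun ⟨y, z⟩ => ?_
    rw [hcd, hc, hd]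
    simp
  · rw [hi, map_sum]; simp [hθ1]
  · rw [hi, map_sum, map_sum]; simp [hθ2]
  · rw [hi, map_sum, map_sum]; simp [hθ3]

end Spectral

section Correlation

/-- Left translation on the space of real functions on a finite group. -/
noncomputable def leftTranslation (Γ : Type*) [Group Γ] [Fintype Γ] :
    Γ →* (EuclideanSpace ℝ Γ ≃ₗᵢ[ℝ] EuclideanSpace ℝ Γ) where
  toFun g := LinearIsometryEquiv.piLpCongrLeft 2 ℝ ℝ (Equiv.mulLeft g)
  map_one' := by
    ext f x
    simp only [LinearIsometryEquiv.piLpCongrLeft_apply, Equiv.piCongrLeft']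
    exact congrArg f.ofLp (by simp; rfl)
  map_mul' g h := by
    ext f x
    simp only [LinearIsometryEquiv.piLpCongrLeft_apply, Equiv.piCongrLeft']
    exact congrArg f.ofLp (by simp; rfl)

theorem leftTranslation_apply {Γ : Type*} [Group Γ] [Fintype Γ] (g x : Γ)
    (f : EuclideanSpace ℝ Γ) : leftTranslation Γ g f x = f (g⁻¹ * x) := by
  simp [leftTranslation, LinearIsometryEquiv.piLpCongrLeft_apply, Equiv.piCongrLeft']

variable {F V : Type*} [Field F] [Fintype F] [AddCommGroup V] [Module F V]
  [FiniteDimensional F V] [Fintype (V ≃ₗ[F] V)]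

open Classical in
/-- Decay of the autocorrelation of a class function with zero sum on determinant cosets. -/
theorem abs_sum_mul_translate_le {f : (V ≃ₗ[F] V) → ℝ} (hconj : ∀ g h, f (h * g * h⁻¹) = f g)
    (hsum : ∀ δ : Fˣ, ∑ x with LinearEquiv.det x = δ, f x = 0) {e b : ℕ} {u : V ≃ₗ[F] V}
    (hu : ∀ α : F, finrank F (LinearMap.ker ((u : V →ₗ[F] V) - α • LinearMap.id)) ≤ e)
    (hb : b ≠ 0) (h : e + 5 * b ≤ finrank F V) (h' : 10 * b ≤ finrank F V) :
    |∑ x, f x * f (u⁻¹ * x)| ≤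
      64 * finrank F V / √(Fintype.card F ^ b) * ∑ x, f x ^ 2 := by
  obtain ⟨p, hp⟩ := CharP.exists F
  have : Fact p.Prime := ⟨CharP.char_is_prime F p⟩
  have : NeZero b := ⟨hb⟩
  let L := FiniteField.Extension F p b
  have hL : finrank F L = b := FiniteField.finrank_extension F p b
  have : Fintype L := Fintype.ofFinite L
  have hcard : Fintype.card L = Fintype.card F ^ b := by
    rw [Module.card_eq_pow_finrank (K := F) (V := L), hL]
  let f' : EuclideanSpace ℝ (V ≃ₗ[F] V) := WithLp.toLp 2 f
  have hf' : ∀ x, f' x = f x := fun _ => rfl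
  have hinner : ∀ g, ⟪f', leftTranslation _ g f'⟫_ℝ = ∑ x, f x * f (g⁻¹ * x) := by
    intro g
    rw [PiLp.inner_apply]
    refine Finset.sum_congr rfl fun x _ => ?_
    rw [leftTranslation_apply, hf', hf', Real.inner_apply]
  have hnorm : ‖f'‖ ^ 2 = ∑ x, f x ^ 2 := by
    rw [EuclideanSpace.norm_sq_eq]
    simp [hf']
  obtain ⟨i, j, h₁, h₂, h₃, h₄, h₅⟩ := exists_incl_proj (L := L) hu (by rw [hL]; exact h)
  have key := abs_inner_le_of_frame (leftTranslation (V ≃ₗ[F] V)) (f := f')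
    (S := Finset.univ.filter fun s => LinearEquiv.det s = 1)
    (fun s hs => (Finset.mem_filter.1 hs).2) ⟨1, by simp⟩ ?_ ?_ (by rw [hL]; exact h')
    h₁ h₂ h₃ h₄ h₅
  · rw [hinner, hnorm, hcard] at key
    exact_mod_cast key
  · intro g
    ext x
    rw [WithLp.ofLp_sum, Finset.sum_apply, PiLp.zero_apply]
    rw [← hsum (LinearEquiv.det g⁻¹ * LinearEquiv.det x)]
    refine Finset.sum_bij' (fun s _ => (s * g)⁻¹ * x) (fun y _ => x * y⁻¹ * g⁻¹) ?_ ?_ ?_ ?_ ?_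
    · intro s hs
      simp only [Finset.mem_filter, Finset.mem_univ, true_and] at hs ⊢
      simp [hs]
    · intro y hy
      simp only [Finset.mem_filter, Finset.mem_univ, true_and] at hy ⊢
      simp [hy]
    · intro s _
      group
    · intro y _
      group
    · intro s _
      exact leftTranslation_apply _ _ _
  · intro g k
    rw [hinner, hinner]
    refine Fintype.sum_equiv (MulAut.conj k⁻¹).toEquiv _ _ fun x => ?_
    simp only [MulEquiv.toEquiv_eq_coe, MulEquiv.coe_toEquiv, MulAut.conj_apply]
    rw [hconj x k⁻¹]
    congr 1
    rw [← hconj _ k⁻¹]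
    congr 1
    group

end Correlation

section Trajectories

variable {F V : Type*} [Field F] [AddCommGroup V] [Module F V]

/-- The interleaved trajectory of a vector: step `k + 1` applies `x (lab k)` to the vector
reached two steps earlier (or to the initial vector, if there is none). -/
def trajectory (lab : ℕ → Bool) (x : Bool → V ≃ₗ[F] V) (v : V) : ℕ → V
  | 0 => v
  | k + 1 => x (lab k) (trajectory lab x v (k - 1))
  termination_by k => k
  decreasing_by omega

theorem trajectory_zero (lab : ℕ → Bool) (x : Bool → V ≃ₗ[F] V) (v : V) :
    trajectory lab x v 0 = v := by rw [trajectory]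

theorem trajectory_succ (lab : ℕ → Bool) (x : Bool → V ≃ₗ[F] V) (v : V) (k : ℕ) :
    trajectory lab x v (k + 1) = x (lab k) (trajectory lab x v (k - 1)) := by rw [trajectory]

/-- The first `K + 1` vectors of the trajectory are independent and span the next one. -/
def ClosesAt (lab : ℕ → Bool) (v : V) (K : ℕ) (x : Bool → V ≃ₗ[F] V) : Prop :=
  LinearIndependent F (fun j : Fin (K + 1) => trajectory lab x v j) ∧
    trajectory lab x v (K + 1) ∈
      Submodule.span F (Set.range fun j : Fin (K + 1) => trajectory lab x v j)

theorem exists_closesAt {lab : ℕ → Bool} {v : V} {x : Bool → V ≃ₗ[F] V} (hv : v ≠ 0) {N : ℕ}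
    (h : ¬ LinearIndependent F (fun j : Fin (N + 1) => trajectory lab x v j)) :
    ∃ K < N, ClosesAt lab v K x := by
  induction N with
  | zero =>
    refine absurd ?_ h
    have : Unique (Fin (0 + 1)) := inferInstanceAs (Unique (Fin 1))
    rw [linearIndependent_unique_iff]
    rw [Nat.lt_one_iff.1 (Fin.is_lt _), trajectory_zero]
    exact hv
  | succ N ih =>
    by_cases hN : LinearIndependent F (fun j : Fin (N + 1) => trajectory lab x v j)
    · refine ⟨N, Nat.lt_succ_self N, hN, ?_⟩
      by_contra hmem
      refine h ?_
      have := hN.finSnoc hmem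
      convert this using 1
      ext j
      refine Fin.lastCases ?_ (fun j => ?_) j
      · simp
      · simp
    · obtain ⟨K, hK, hc⟩ := ih hN
      exact ⟨K, hK.trans (Nat.lt_succ_self N), hc⟩

/-- The part of the trajectory up to time `K` that is constrained by the generator `lab K`. -/
def usedSpan (lab : ℕ → Bool) (v : V) (K : ℕ) (x : Bool → V ≃ₗ[F] V) : Submodule F V :=
  Submodule.span F {y | ∃ j < K, lab j = lab K ∧ trajectory lab x v (j + 1) = y}

theorem usedSpan_le (lab : ℕ → Bool) (v : V) (K : ℕ) (x : Bool → V ≃ₗ[F] V) :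
    usedSpan lab v K x ≤
      Submodule.span F (Set.range fun j : Fin (K + 1) => trajectory lab x v j) := by
  refine Submodule.span_mono ?_
  rintro _ ⟨j, hj, -, rfl⟩
  exact ⟨⟨j + 1, by omega⟩, rfl⟩

theorem finrank_usedSpan_le [FiniteDimensional F V] (lab : ℕ → Bool) (v : V) (K : ℕ)
    (x : Bool → V ≃ₗ[F] V) : finrank F (usedSpan lab v K x) ≤ K := by
  have h : usedSpan lab v K x ≤
      Submodule.span F (Set.range fun j : Fin K => trajectory lab x v (j + 1)) := by
    refine Submodule.span_mono ?_
    rintro _ ⟨j, hj, -, rfl⟩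
    exact ⟨⟨j, hj⟩, rfl⟩
  refine (Submodule.finrank_mono h).trans ((finrank_range_le_card _).trans ?_)
  simp

theorem notMem_usedSpan {lab : ℕ → Bool} (hlab : lab 0 ≠ lab 1) {v : V} {K : ℕ}
    {x : Bool → V ≃ₗ[F] V}
    (h : LinearIndependent F (fun j : Fin (K + 1) => trajectory lab x v j)) :
    trajectory lab x v (K + 1) ∉ usedSpan lab v K x := by
  intro hmem
  let s : Set (Fin (K + 1)) := {i | ∃ j < K, lab j = lab K ∧ (i : ℕ) = j - 1}
  have hs : (⟨K - 1, by omega⟩ : Fin (K + 1)) ∉ s := by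
    rintro ⟨j, hj, hl, hij⟩
    have h1 : j = 0 ∧ K = 1 := by simp only at hij; omega
    obtain ⟨rfl, rfl⟩ := h1
    exact hlab hl
  refine h.notMem_span_image hs ?_
  have hle : usedSpan lab v K x ≤ (Submodule.span F
      ((fun j : Fin (K + 1) => trajectory lab x v j) '' s)).map (x (lab K) : V →ₗ[F] V) := by
    refine Submodule.span_le.2 ?_
    rintro _ ⟨j, hj, hl, rfl⟩
    refine ⟨trajectory lab x v (j - 1), Submodule.subset_span ⟨⟨j - 1, by omega⟩,
      ⟨j, hj, hl, rfl⟩, rfl⟩, ?_⟩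
    rw [trajectory_succ, hl]
    rfl
  obtain ⟨y, hy, hyK⟩ := hle hmem
  rw [trajectory_succ] at hyK
  rwa [← (x (lab K)).injective hyK]

theorem trajectory_update {lab : ℕ → Bool} {v : V} {K : ℕ} {x : Bool → V ≃ₗ[F] V}
    {g : V ≃ₗ[F] V} (hg : ∀ w ∈ usedSpan lab v K x, g w = w) :
    (∀ j ≤ K, trajectory lab (Function.update x (lab K) (g * x (lab K))) v j =
      trajectory lab x v j) ∧
    trajectory lab (Function.update x (lab K) (g * x (lab K))) v (K + 1) =
      g (trajectory lab x v (K + 1)) := by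
  have key : ∀ j ≤ K, trajectory lab (Function.update x (lab K) (g * x (lab K))) v j =
      trajectory lab x v j := by
    intro j
    induction j using Nat.strong_induction_on with
    | _ j ih =>
      intro hj
      rcases j with _ | j
      · rw [trajectory_zero, trajectory_zero]
      · rw [trajectory_succ, ih (j - 1) (by omega) (by omega)]
        by_cases hl : lab j = lab K
        · have hmem : trajectory lab x v (j + 1) ∈ usedSpan lab v K x :=
            Submodule.subset_span ⟨j, by omega, hl, rfl⟩
          rw [hl, Function.update_self, LinearEquiv.mul_apply, ← hl, ← trajectory_succ, hg _ hmem]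
        · rw [Function.update_of_ne hl, trajectory_succ]
  refine ⟨key, ?_⟩
  rw [trajectory_succ, key _ (by omega), Function.update_self, LinearEquiv.mul_apply,
    trajectory_succ]

variable [FiniteDimensional F V] [Fintype F] {H : Subgroup (V ≃ₗ[F] V)} [Fintype H]

open Classical in
theorem card_closesAt_mul_le (hH : ∀ g : V ≃ₗ[F] V, LinearEquiv.det g = 1 → g ∈ H)
    {lab : ℕ → Bool} (hlab : lab 0 ≠ lab 1) (v : V) {K : ℕ} (hK : K + 2 ≤ finrank F V) :
    (Finset.univ.filter fun x : Bool → H => ClosesAt lab v K fun b => (x b : V ≃ₗ[F] V)).card *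
      (Fintype.card F ^ finrank F V - Fintype.card F ^ (K + 1)) ≤
      Fintype.card F ^ (K + 1) * Fintype.card H ^ 2 := by
  have : Finite V := Module.finite_of_finite F
  have : Fintype V := Fintype.ofFinite V
  let c : (Bool → H) → Bool → V ≃ₗ[F] V := fun x b => x b
  have hg : ∀ (U : Submodule F V) (y e : V), ∃ g : H, y ∉ U → e ∉ U →
      finrank F U + 2 ≤ finrank F V →
      (∀ w ∈ U, (g : V ≃ₗ[F] V) w = w) ∧ (g : V ≃ₗ[F] V) y = e := by
    intro U y e
    by_cases h : y ∉ U ∧ e ∉ U ∧ finrank F U + 2 ≤ finrank F V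
    · obtain ⟨t, ht, h1, h2⟩ := exists_det_eq_one_apply_eq h.1 h.2.1 h.2.2
      exact ⟨⟨t, hH t ht⟩, fun _ _ _ => ⟨h1, h2⟩⟩
    · exact ⟨1, fun a b c => absurd ⟨a, b, c⟩ h⟩
  choose g hg using hg
  let Y : (Bool → H) → Submodule F V := fun x =>
    Submodule.span F (Set.range fun j : Fin (K + 1) => trajectory lab (c x) v j)
  let B := Finset.univ.filter fun x : Bool → H => ClosesAt lab v K (c x)
  have hB : ∀ x ∈ B, ClosesAt lab v K (c x) := fun x hx => (Finset.mem_filter.1 hx).2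
  let gx : (Bool → H) → V → H := fun x e =>
    g (usedSpan lab v K (c x)) (trajectory lab (c x) v (K + 1)) e
  let Ψ : (Bool → H) → V → (Bool → H) := fun x e =>
    Function.update x (lab K) (gx x e * x (lab K))
  have hcΨ : ∀ x e, c (Ψ x e) = Function.update (c x) (lab K)
      ((gx x e : V ≃ₗ[F] V) * c x (lab K)) := by
    intro x e
    ext1 b
    by_cases hb : b = lab K
    · subst hb; simp [c, Ψ]
    · simp [c, Ψ, Function.update_of_ne hb]
  have hgx : ∀ x ∈ B, ∀ e ∉ Y x, (∀ w ∈ usedSpan lab v K (c x), (gx x e : V ≃ₗ[F] V) w = w) ∧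
      (gx x e : V ≃ₗ[F] V) (trajectory lab (c x) v (K + 1)) = e := fun x hx e he =>
    hg _ _ _ (notMem_usedSpan hlab (hB x hx).1) (fun h => he (usedSpan_le _ _ _ _ h))
      (by have := finrank_usedSpan_le lab v K (c x); omega)
  have hΨ : ∀ x ∈ B, ∀ e ∉ Y x,
      (∀ j ≤ K, trajectory lab (c (Ψ x e)) v j = trajectory lab (c x) v j) ∧
      trajectory lab (c (Ψ x e)) v (K + 1) = e := by
    intro x hx e he
    have h := trajectory_update (x := c x) (hgx x hx e he).1
    rw [← hcΨ, (hgx x hx e he).2] at h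
    exact h
  have hcoef : ∀ x : Bool → H, ∃ a : Fin (K + 1) → F, x ∈ B →
      ∑ j, a j • trajectory lab (c x) v j = trajectory lab (c x) v (K + 1) := by
    intro x
    by_cases hx : x ∈ B
    · obtain ⟨a, ha⟩ := (Submodule.mem_span_range_iff_exists_fun F).1 (hB x hx).2
      exact ⟨a, fun _ => ha⟩
    · exact ⟨0, fun h => absurd h hx⟩
  choose a ha using hcoef
  have hfree : ∀ x ∈ B, (Finset.univ.filter fun e : V => e ∉ Y x).card =
      Fintype.card F ^ finrank F V - Fintype.card F ^ (K + 1) := by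
    intro x hx
    have h1 : (Finset.univ.filter fun e : V => e ∈ Y x).card = Fintype.card F ^ (K + 1) := by
      rw [← Fintype.card_subtype, Module.card_eq_pow_finrank (K := F) (V := Y x),
        finrank_span_eq_card (hB x hx).1, Fintype.card_fin]
    have h2 := Finset.card_filter_add_card_filter_not (s := Finset.univ) (fun e : V => e ∈ Y x)
    rw [Finset.card_univ, Module.card_eq_pow_finrank (K := F) (V := V)] at h2
    omega
  have hcount : (B.sigma fun x => Finset.univ.filter fun e : V => e ∉ Y x).card =
      B.card * (Fintype.card F ^ finrank F V - Fintype.card F ^ (K + 1)) := by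
    rw [Finset.card_sigma, Finset.sum_congr rfl hfree, Finset.sum_const, smul_eq_mul]
  change B.card * _ ≤ _
  rw [← hcount]
  have htarget : (Finset.univ : Finset ((Fin (K + 1) → F) × (Bool → H))).card =
      Fintype.card F ^ (K + 1) * Fintype.card H ^ 2 := by simp
  rw [← htarget]
  refine Finset.card_le_card_of_injOn (fun p => (a p.1, Ψ p.1 p.2)) (fun _ _ => by simp) ?_
  rintro ⟨x, e⟩ hx ⟨y, e'⟩ hy hxy
  simp only [Finset.coe_sigma, Set.mem_sigma_iff, Finset.mem_coe, Finset.mem_filter,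
    Finset.mem_univ, true_and] at hx hy
  simp only [Prod.mk.injEq] at hxy
  obtain ⟨hax, hΨxy⟩ := hxy
  obtain ⟨hx1, hx2⟩ := hΨ x hx.1 e hx.2
  obtain ⟨hy1, hy2⟩ := hΨ y hy.1 e' hy.2
  rw [hΨxy] at hx1 hx2
  have he : e = e' := hx2.symm.trans hy2
  subst he
  have htraj : ∀ j ≤ K, trajectory lab (c x) v j = trajectory lab (c y) v j := fun j hj =>
    (hx1 j hj).symm.trans (hy1 j hj)
  have hlast : trajectory lab (c x) v (K + 1) = trajectory lab (c y) v (K + 1) := by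
    rw [← ha x hx.1, ← ha y hy.1, hax]
    exact Finset.sum_congr rfl fun j _ => by rw [htraj j (by omega)]
  have hused : usedSpan lab v K (c x) = usedSpan lab v K (c y) := by
    unfold usedSpan
    congr 1
    ext z
    constructor
    · rintro ⟨j, hj, hl, rfl⟩
      exact ⟨j, hj, hl, (htraj _ (by omega)).symm⟩
    · rintro ⟨j, hj, hl, rfl⟩
      exact ⟨j, hj, hl, htraj _ (by omega)⟩
  have hgxy : gx x e = gx y e := by simp only [gx, hused, hlast]
  have hxy : x = y := by
    ext1 b
    have hb := congrFun hΨxy b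
    by_cases hbl : b = lab K
    · subst hbl
      simpa [Ψ, hgxy] using hb
    · simpa [Ψ, Function.update_of_ne hbl] using hb
  rw [hxy]

end Trajectories

section PositiveWords

/-- The value of a positive word; the first letter of the word acts first. -/
def wordEval {Γ : Type*} [Monoid Γ] (x : Bool → Γ) : List Bool → Γ
  | [] => 1
  | s :: w => wordEval x w * x s

theorem wordEval_append {Γ : Type*} [Monoid Γ] (x : Bool → Γ) (w w' : List Bool) :
    wordEval x (w ++ w') = wordEval x w' * wordEval x w := by
  induction w with
  | nil => simp [wordEval]
  | cons s w ih => simp [wordEval, ih, mul_assoc]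

theorem wordEval_take_succ {Γ : Type*} [Monoid Γ] (x : Bool → Γ) {w : List Bool} {i : ℕ}
    (hi : i < w.length) :
    wordEval x (w.take (i + 1)) = x (w.getD i false) * wordEval x (w.take i) := by
  rw [List.take_succ_eq_append_getElem hi, wordEval_append, List.getD_eq_getElem _ _ hi]
  simp [wordEval]

theorem map_wordEval {Γ Δ : Type*} [Monoid Γ] [Monoid Δ] (φ : Γ →* Δ) (x : Bool → Γ)
    (w : List Bool) : φ (wordEval x w) = wordEval (fun b => φ (x b)) w := by
  induction w with
  | nil => simp [wordEval]
  | cons s w ih => simp [wordEval, ih]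

variable {F V : Type*} [Field F] [AddCommGroup V] [Module F V]

/-- The letters of two words, alternating. -/
def interleave (w w' : List Bool) (k : ℕ) : Bool :=
  if k % 2 = 0 then w.getD (k / 2) false else w'.getD (k / 2) false

theorem trajectory_interleave {w w' : List Bool} {ℓ : ℕ} (hw : w.length = ℓ) (hw' : w'.length = ℓ)
    (x : Bool → V ≃ₗ[F] V) (v : V) {i : ℕ} (hi : i < ℓ) :
    trajectory (interleave w w') x v (2 * i + 1) = wordEval x (w.take (i + 1)) v ∧
    trajectory (interleave w w') x v (2 * i + 2) = wordEval x (w'.take (i + 1)) v := by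
  induction i with
  | zero =>
    rw [trajectory_succ, trajectory_succ, wordEval_take_succ x (w := w) (by omega),
      wordEval_take_succ x (w := w') (by omega), LinearEquiv.mul_apply, LinearEquiv.mul_apply]
    simp [trajectory_zero, wordEval, interleave]
  | succ i ih =>
    obtain ⟨h1, h2⟩ := ih (by omega)
    have h3 : interleave w w' (2 * (i + 1)) = w.getD (i + 1) false := by simp [interleave]
    have h4 : interleave w w' (2 * (i + 1) + 1) = w'.getD (i + 1) false := by
      simp [interleave, show (2 * (i + 1) + 1) / 2 = i + 1 by omega]
    rw [trajectory_succ, trajectory_succ, h3, h4, wordEval_take_succ x (w := w) (by omega),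
      wordEval_take_succ x (w := w') (by omega), LinearEquiv.mul_apply, LinearEquiv.mul_apply,
      show 2 * (i + 1) - 1 = 2 * i + 1 by omega, h1,
      show 2 * (i + 1) + 1 - 1 = 2 * i + 2 by omega, h2]
    exact ⟨rfl, rfl⟩

theorem exists_closesAt_of_smul_eq {w w' : List Bool} {ℓ : ℕ} (hℓ : ℓ ≠ 0) (hw : w.length = ℓ)
    (hw' : w'.length = ℓ) {x : Bool → V ≃ₗ[F] V} {v : V} (hv : v ≠ 0) {α : F}
    (h : wordEval x w v = α • wordEval x w' v) :
    ∃ K < 2 * ℓ, ClosesAt (interleave w w') v K x := by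
  refine exists_closesAt hv fun hind => ?_
  obtain ⟨h1, h2⟩ := trajectory_interleave hw hw' x v (show ℓ - 1 < ℓ by omega)
  rw [show ℓ - 1 + 1 = ℓ by omega, List.take_of_length_le (by omega)] at h1 h2
  rw [show 2 * (ℓ - 1) + 2 = 2 * ℓ by omega] at h2
  let i : Fin (2 * ℓ + 1) := ⟨2 * (ℓ - 1) + 1, by omega⟩
  let j : Fin (2 * ℓ + 1) := ⟨2 * ℓ, by omega⟩
  have hij : i ∉ ({j} : Set (Fin (2 * ℓ + 1))) := by
    simp only [Set.mem_singleton_iff, i, j, Fin.mk.injEq]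
    omega
  refine hind.notMem_span_image hij ?_
  rw [Set.image_singleton, Submodule.mem_span_singleton]
  exact ⟨α, by simp only [i, j]; rw [h1, h2, h]⟩

variable [FiniteDimensional F V] [Fintype F] {H : Subgroup (V ≃ₗ[F] V)} [Fintype H]

open Classical in
theorem card_smul_eq_mul_le (hH : ∀ g : V ≃ₗ[F] V, LinearEquiv.det g = 1 → g ∈ H)
    {w w' : List Bool} {ℓ : ℕ} (hw : w.length = ℓ) (hw' : w'.length = ℓ)
    (hhead : w.getD 0 false ≠ w'.getD 0 false) (hn : 2 * ℓ + 1 ≤ finrank F V) {v : V}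
    (hv : v ≠ 0) :
    (Finset.univ.filter fun x : Bool → H => ∃ α : F,
      wordEval (fun b => (x b : V ≃ₗ[F] V)) w v =
        α • wordEval (fun b => (x b : V ≃ₗ[F] V)) w' v).card * Fintype.card F ^ finrank F V ≤
      4 * ℓ * Fintype.card F ^ (2 * ℓ) * Fintype.card H ^ 2 := by
  have hℓ : ℓ ≠ 0 := by
    rintro rfl
    rw [List.length_eq_zero_iff] at hw hw'
    simp [hw, hw'] at hhead
  have hlab : interleave w w' 0 ≠ interleave w w' 1 := by simpa [interleave] using hhead
  have hq : 2 ≤ Fintype.card F := Fintype.one_lt_card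
  have hK : ∀ K ∈ Finset.range (2 * ℓ), (Finset.univ.filter fun x : Bool → H =>
      ClosesAt (interleave w w') v K fun b => (x b : V ≃ₗ[F] V)).card *
        Fintype.card F ^ finrank F V ≤ 2 * Fintype.card F ^ (2 * ℓ) * Fintype.card H ^ 2 := by
    intro K hK
    rw [Finset.mem_range] at hK
    have h := card_closesAt_mul_le hH hlab v (K := K) (by omega)
    have h1 : Fintype.card F ^ (K + 1) ≤ Fintype.card F ^ (2 * ℓ) :=
      Nat.pow_le_pow_right (by omega) (by omega)
    have h2 : 2 * Fintype.card F ^ (K + 1) ≤ Fintype.card F ^ finrank F V :=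
      calc _ ≤ Fintype.card F * Fintype.card F ^ (K + 1) := Nat.mul_le_mul_right _ hq
        _ = Fintype.card F ^ (K + 1 + 1) := by ring
        _ ≤ _ := Nat.pow_le_pow_right (by omega) (by omega)
    have h3 : Fintype.card F ^ finrank F V ≤
        2 * (Fintype.card F ^ finrank F V - Fintype.card F ^ (K + 1)) := by omega
    calc _ ≤ _ * (2 * (Fintype.card F ^ finrank F V - Fintype.card F ^ (K + 1))) :=
          Nat.mul_le_mul_left _ h3
      _ ≤ 2 * (Fintype.card F ^ (K + 1) * Fintype.card H ^ 2) := by linarith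
      _ ≤ 2 * (Fintype.card F ^ (2 * ℓ) * Fintype.card H ^ 2) := by gcongr
      _ = _ := by ring
  have hsub : (Finset.univ.filter fun x : Bool → H => ∃ α : F,
      wordEval (fun b => (x b : V ≃ₗ[F] V)) w v =
        α • wordEval (fun b => (x b : V ≃ₗ[F] V)) w' v) ⊆
      (Finset.range (2 * ℓ)).biUnion fun K => Finset.univ.filter fun x : Bool → H =>
        ClosesAt (interleave w w') v K fun b => (x b : V ≃ₗ[F] V) := by
    intro x hx
    simp only [Finset.mem_filter, Finset.mem_univ, true_and] at hx
    obtain ⟨α, hα⟩ := hx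
    obtain ⟨K, hK, hc⟩ := exists_closesAt_of_smul_eq hℓ hw hw' hv hα
    exact Finset.mem_biUnion.2 ⟨K, Finset.mem_range.2 hK, by simpa using hc⟩
  calc _ ≤ (∑ K ∈ Finset.range (2 * ℓ), (Finset.univ.filter fun x : Bool → H =>
      ClosesAt (interleave w w') v K fun b => (x b : V ≃ₗ[F] V)).card) *
        Fintype.card F ^ finrank F V :=
        Nat.mul_le_mul_right _ ((Finset.card_le_card hsub).trans Finset.card_biUnion_le)
    _ ≤ ∑ K ∈ Finset.range (2 * ℓ), 2 * Fintype.card F ^ (2 * ℓ) * Fintype.card H ^ 2 := by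
        rw [Finset.sum_mul]; exact Finset.sum_le_sum hK
    _ = _ := by rw [Finset.sum_const, Finset.card_range, smul_eq_mul]; ring

open Classical in
theorem sum_card_smul_eq_le [Fintype V] (hH : ∀ g : V ≃ₗ[F] V, LinearEquiv.det g = 1 → g ∈ H)
    {w w' : List Bool} {ℓ : ℕ} (hw : w.length ≤ ℓ) (hw' : w'.length = w.length)
    (hne : w ≠ w') (hn : 2 * ℓ + 1 ≤ finrank F V) :
    ∑ x : Bool → H, (Finset.univ.filter fun v : V => v ≠ 0 ∧ ∃ α : F,
      wordEval (fun b => (x b : V ≃ₗ[F] V)) w v =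
        α • wordEval (fun b => (x b : V ≃ₗ[F] V)) w' v).card ≤
      4 * ℓ * Fintype.card F ^ (2 * ℓ) * Fintype.card H ^ 2 := by
  have hq : 0 < Fintype.card F := Fintype.card_pos
  by_cases hhead : w.getD 0 false ≠ w'.getD 0 false
  · refine Nat.le_of_mul_le_mul_right ?_ (pow_pos hq (finrank F V))
    calc _ = (∑ v : V, if v ≠ 0 then (Finset.univ.filter fun x : Bool → H => ∃ α : F,
          wordEval (fun b => (x b : V ≃ₗ[F] V)) w v =
          α • wordEval (fun b => (x b : V ≃ₗ[F] V)) w' v).card else 0) *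
          Fintype.card F ^ finrank F V := by
          congr 1
          simp only [Finset.card_filter]
          rw [Finset.sum_comm]
          refine Finset.sum_congr rfl fun v _ => ?_
          by_cases hv : v = 0 <;> simp [hv]
      _ ≤ ∑ v : V, 4 * ℓ * Fintype.card F ^ (2 * ℓ) * Fintype.card H ^ 2 := by
          rw [Finset.sum_mul]
          refine Finset.sum_le_sum fun v _ => ?_
          split_ifs with hv
          · refine (card_smul_eq_mul_le hH rfl hw' hhead (by omega) hv).trans ?_
            gcongr
          · simp
      _ = _ := by
          rw [Finset.sum_const, Finset.card_univ, Module.card_eq_pow_finrank (K := F) (V := V),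
            smul_eq_mul, mul_comm]
  · push Not at hhead
    match w, w', hw, hw', hne, hhead with
    | [], [], _, _, hne, _ => exact absurd rfl hne
    | s :: c, s' :: c', hw, hw', hne, hhead =>
      obtain rfl : s = s' := by simpa using hhead
      refine le_trans (le_of_eq ?_) (sum_card_smul_eq_le hH (w := c) (w' := c')
        (ℓ := ℓ) (by simp at hw; omega) (by simpa using hw') (fun h => hne (by rw [h])) hn)
      refine Finset.sum_congr rfl fun x _ => ?_
      refine Finset.card_bij' (fun v _ => (x s : V ≃ₗ[F] V) v)
        (fun v _ => (x s : V ≃ₗ[F] V).symm v) ?_ ?_ (by simp) (by simp)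
      · intro v hv
        simpa [wordEval] using (Finset.mem_filter.1 hv).2
      · intro v hv
        rw [Finset.mem_filter]
        simpa [wordEval] using hv

/-- All eigenspaces have dimension at most `e`. -/
def EigenspacesLE (e : ℕ) (u : V ≃ₗ[F] V) : Prop :=
  ∀ α : F, finrank F (LinearMap.ker ((u : V →ₗ[F] V) - α • LinearMap.id)) ≤ e

open Classical in
theorem card_not_eigenspacesLE_mul_le (hH : ∀ g : V ≃ₗ[F] V, LinearEquiv.det g = 1 → g ∈ H)
    {w w' : List Bool} {ℓ : ℕ} (hw : w.length = ℓ) (hw' : w'.length = ℓ)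
    (hne : w ≠ w') (hn : 2 * ℓ + 1 ≤ finrank F V) (e : ℕ) :
    (Finset.univ.filter fun x : Bool → H =>
      ¬ EigenspacesLE e (wordEval (fun b => (x b : V ≃ₗ[F] V)) w *
        (wordEval (fun b => (x b : V ≃ₗ[F] V)) w')⁻¹)).card * Fintype.card F ^ e ≤
      4 * ℓ * Fintype.card F ^ (2 * ℓ) * Fintype.card H ^ 2 := by
  have : Finite V := Module.finite_of_finite F
  have : Fintype V := Fintype.ofFinite V
  have hq : 2 ≤ Fintype.card F := Fintype.one_lt_card
  refine le_trans ?_ (sum_card_smul_eq_le hH hw.le (hw'.trans hw.symm) hne hn)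
  rw [← smul_eq_mul, ← Finset.sum_const]
  refine (Finset.sum_le_sum fun x hx => ?_).trans
    (Finset.sum_le_sum_of_subset (Finset.subset_univ _))
  simp only [Finset.mem_filter, Finset.mem_univ, true_and, EigenspacesLE, not_forall,
    not_le] at hx
  obtain ⟨α, hα⟩ := hx
  set a := wordEval (fun b => (x b : V ≃ₗ[F] V)) w
  set b := wordEval (fun b => (x b : V ≃ₗ[F] V)) w'
  set N := LinearMap.ker (((a * b⁻¹ : V ≃ₗ[F] V) : V →ₗ[F] V) - α • LinearMap.id)
  have hmem : ∀ v, v ∈ N ↔ a (b⁻¹ v) = α • v := by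
    intro v
    simp [N, sub_eq_zero]
  have hcard : (Finset.univ.filter fun v : V => v ∈ N).card = Fintype.card F ^ finrank F N := by
    rw [← Fintype.card_subtype]
    exact Module.card_eq_pow_finrank (K := F) (V := N)
  have h1 : Fintype.card F ^ e + 1 ≤ Fintype.card F ^ finrank F N :=
    Nat.pow_lt_pow_right (by omega) hα
  have h2 : ((Finset.univ.filter fun v : V => v ∈ N).erase 0).card =
      Fintype.card F ^ finrank F N - 1 := by
    rw [Finset.card_erase_of_mem (by simp), hcard]
  refine (show _ ≤ ((Finset.univ.filter fun v : V => v ∈ N).erase 0).card by omega).trans ?_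
  refine Finset.card_le_card_of_injOn (fun v => b⁻¹ v) ?_ (b⁻¹).injective.injOn
  intro v hv
  simp only [Finset.coe_erase, Set.mem_sdiff, Finset.mem_coe, Finset.mem_filter, Finset.mem_univ,
    true_and, Set.mem_singleton_iff, hmem] at hv
  simp only [Finset.coe_filter, Set.mem_ofPred_eq, Finset.mem_univ, true_and]
  refine ⟨by simpa using hv.2, α, ?_⟩
  rw [hv.1, ← LinearEquiv.mul_apply, mul_inv_cancel]
  rfl

end PositiveWords

section MatrixEquiv

variable {F : Type*} [Field F] {n : ℕ}

/-- Invertible matrices as linear automorphisms. -/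
noncomputable def glEquiv (F : Type*) [Field F] (n : ℕ) :
    GL (Fin n) F ≃* ((Fin n → F) ≃ₗ[F] (Fin n → F)) :=
  Matrix.GeneralLinearGroup.toLin.trans (LinearMap.GeneralLinearGroup.generalLinearEquiv F _)

theorem coe_glEquiv (g : GL (Fin n) F) :
    (glEquiv F n g : (Fin n → F) →ₗ[F] (Fin n → F)) = (g : Matrix (Fin n) (Fin n) F).mulVecLin := by
  ext
  simp [glEquiv]

theorem det_glEquiv (g : GL (Fin n) F) :
    LinearEquiv.det (glEquiv F n g) = Matrix.GeneralLinearGroup.det g := by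
  ext
  rw [LinearEquiv.coe_det, coe_glEquiv]
  exact LinearMap.det_toLin' _

theorem finrank_range_glEquiv_sub_id (g : GL (Fin n) F) :
    finrank F (LinearMap.range ((glEquiv F n g : (Fin n → F) →ₗ[F] (Fin n → F)) - LinearMap.id)) =
      ((g : Matrix (Fin n) (Fin n) F) - 1).rank := by
  have h : (g : Matrix (Fin n) (Fin n) F).mulVecLin - LinearMap.id =
      ((g : Matrix (Fin n) (Fin n) F) - 1).mulVecLin := by
    ext
    simp
  rw [coe_glEquiv, Matrix.rank, h]

theorem rank_single {i j : Fin n} {c : F} (hc : c ≠ 0) : (Matrix.single i j c).rank = 1 := by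
  have h : Matrix.single i j c = Matrix.vecMulVec (Pi.single i c) (Pi.single j 1) := by
    ext a b
    simp [Matrix.single_apply, Matrix.vecMulVec_apply, Pi.single_apply]
    grind
  refine le_antisymm ?_ ?_
  · rw [h]
    exact Matrix.rank_vecMulVec_le _ _
  · rw [Nat.one_le_iff_ne_zero, Ne, Matrix.rank, Submodule.finrank_eq_zero, LinearMap.range_eq_bot]
    intro h0
    exact hc (by simpa using congrFun (LinearMap.congr_fun h0 (Pi.single j 1)) i)

theorem transvection_pow {i j : Fin n} (hij : i ≠ j) (m : ℕ) :
    (Matrix.transvection i j (1 : F)) ^ m = Matrix.transvection i j (m : F) := by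
  induction m with
  | zero => simp
  | succ m ih => rw [pow_succ, ih, Matrix.transvection_mul_transvection_same _ _ hij]; simp

variable [Fintype F]

/-- A transvection times a commuting diagonal automorphism of prescribed determinant. -/
theorem exists_transvection_mul_diagonal (hn : 3 ≤ n) (β : Fˣ) :
    ∃ u : (Fin n → F) ≃ₗ[F] (Fin n → F), LinearEquiv.det u = β ∧
      u ^ (Fintype.card F * (Fintype.card F - 1)) = 1 ∧
      ∀ m : ℕ, Fintype.card F - 1 ∣ m → (m : F) ≠ 0 →
        finrank F (LinearMap.range
          (((u ^ m : (Fin n → F) ≃ₗ[F] (Fin n → F)) : (Fin n → F) →ₗ[F] (Fin n → F)) -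
            LinearMap.id)) = 1 := by
  let i : Fin n := ⟨0, by omega⟩
  let j : Fin n := ⟨1, by omega⟩
  let k : Fin n := ⟨2, by omega⟩
  have hij : i ≠ j := by simp [i, j]
  have hik : i ≠ k := by simp [i, k]
  have hjk : j ≠ k := by simp [j, k]
  let D : Matrix (Fin n) (Fin n) F := Matrix.diagonal (Function.update 1 k (β : F))
  let E : Matrix (Fin n) (Fin n) F := Matrix.transvection i j 1
  have hcomm : Commute E D := by
    have h1 : Matrix.single i j (1 : F) * D = D * Matrix.single i j (1 : F) := by
      ext a b
      simp only [D, Matrix.mul_diagonal, Matrix.diagonal_mul, Matrix.single_apply]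
      split_ifs with h
      · obtain ⟨rfl, rfl⟩ := h
        simp [Function.update_of_ne hik, Function.update_of_ne hjk]
      · simp
    change (1 + _) * D = D * (1 + _)
    rw [add_mul, mul_add, h1, one_mul, mul_one]
  have hdet : (E * D).det = β := by
    rw [Matrix.det_mul, Matrix.det_transvection_of_ne _ _ hij, one_mul, Matrix.det_diagonal,
      Finset.prod_update_of_mem (Finset.mem_univ _)]
    simp
  let g : GL (Fin n) F := Matrix.GeneralLinearGroup.mkOfDetNeZero (E * D) (by rw [hdet]; simp)
  have hg : ∀ m : ℕ, Fintype.card F - 1 ∣ m →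
      ((g ^ m : GL (Fin n) F) : Matrix (Fin n) (Fin n) F) = Matrix.transvection i j (m : F) := by
    rintro m ⟨l, rfl⟩
    have hD : D ^ ((Fintype.card F - 1) * l) = 1 := by
      rw [Matrix.diagonal_pow, ← Matrix.diagonal_one]
      congr 1
      ext a
      by_cases ha : a = k
      · subst ha
        simp [pow_mul, FiniteField.pow_card_sub_one_eq_one]
      · simp [Function.update_of_ne ha]
    rw [Units.val_pow_eq_pow_val]
    change (E * D) ^ _ = _
    rw [hcomm.mul_pow, hD, mul_one, transvection_pow hij]
  refine ⟨glEquiv F n g, ?_, ?_, ?_⟩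
  · rw [det_glEquiv]
    ext
    exact hdet
  · rw [← map_pow, EmbeddingLike.map_eq_one_iff]
    ext1
    rw [hg _ (dvd_mul_left _ _)]
    simp
  · intro m hm hm0
    rw [← map_pow, finrank_range_glEquiv_sub_id, hg m hm]
    simp only [Matrix.transvection, add_sub_cancel_left]
    exact rank_single hm0

end MatrixEquiv

section FieldIntertwiner

variable {F L : Type*} [Field F] [Field L] [Algebra F L]

theorem aeval_mul_apply_eq {φ : L →ₗ[F] L} {α β : L} (h : ∀ x, α * φ x = φ (β * x))
    (p : Polynomial F) (x : L) :
    Polynomial.aeval α p * φ x = φ (Polynomial.aeval β p * x) := by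
  induction p using Polynomial.induction_on' with
  | add p q hp hq => simp [add_mul, hp, hq]
  | monomial n c =>
    have hn : ∀ n : ℕ, α ^ n * φ x = φ (β ^ n * x) := by
      intro n
      induction n with
      | zero => simp
      | succ n ih => rw [pow_succ', mul_assoc, ih, h, pow_succ', mul_assoc]
    simp only [Polynomial.aeval_monomial, ← Algebra.smul_def, smul_mul_assoc, hn, map_smul]

theorem minpoly_eq_of_intertwiner [FiniteDimensional F L] {φ : L →ₗ[F] L} {α β : L}
    (h : ∀ x, α * φ x = φ (β * x)) (hφ : φ ≠ 0) : minpoly F α = minpoly F β := by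
  obtain ⟨x, hx⟩ : ∃ x, φ x ≠ 0 := by
    by_contra! h0
    exact hφ (LinearMap.ext h0)
  refine minpoly.eq_of_root (Algebra.IsAlgebraic.isAlgebraic β) ?_
  have := aeval_mul_apply_eq h (minpoly F β) x
  rw [minpoly.aeval, zero_mul, map_zero] at this
  exact (mul_eq_zero.1 this).resolve_right hx

theorem intertwiner_ext {φ ψ : L →ₗ[F] L} {α β : L} (hβ : Algebra.adjoin F {β} = ⊤)
    (hφ : ∀ x, α * φ x = φ (β * x)) (hψ : ∀ x, α * ψ x = ψ (β * x)) (h : φ 1 = ψ 1) : φ = ψ := by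
  ext y
  have hy : y ∈ Algebra.adjoin F {β} := hβ ▸ Algebra.mem_top
  rw [Algebra.adjoin_singleton_eq_range_aeval] at hy
  obtain ⟨p, rfl⟩ := hy
  have h1 := aeval_mul_apply_eq hφ p 1
  have h2 := aeval_mul_apply_eq hψ p 1
  rw [mul_one] at h1 h2
  exact h1.symm.trans ((congrArg _ h).trans h2)

end FieldIntertwiner

section Blocks

variable {F L U : Type*} [Field F] [Field L] [Algebra F L] [AddCommGroup U] [Module F U] {k : ℕ}

/-- A block diagonal automorphism acting on the coordinates in the extension field by
multiplication. -/
def blockEquiv (u : U ≃ₗ[F] U) (a : Fin k → Lˣ) :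
    (U × (Fin k → L)) ≃ₗ[F] (U × (Fin k → L)) :=
  u.prodCongr (LinearEquiv.piCongrRight fun i => DistribMulAction.toLinearEquiv F L (a i))

theorem blockEquiv_apply (u : U ≃ₗ[F] U) (a : Fin k → Lˣ) (p : U × (Fin k → L)) :
    blockEquiv u a p = (u p.1, fun i => (a i : L) * p.2 i) := rfl

theorem blockEquiv_pow (u : U ≃ₗ[F] U) (a : Fin k → Lˣ) (m : ℕ) :
    blockEquiv u a ^ m = blockEquiv (u ^ m) (a ^ m) := by
  induction m with
  | zero => ext p <;> simp [blockEquiv_apply]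
  | succ m ih =>
    rw [pow_succ, ih]
    ext p <;> simp [blockEquiv_apply, pow_succ, mul_assoc]

variable {u u₀ : U ≃ₗ[F] U} {a a₀ : Fin k → Lˣ} {N : ℕ}
  {T : (U × (Fin k → L)) ≃ₗ[F] (U × (Fin k → L))}

theorem blockEquiv_pow_intertwine (h : blockEquiv u a * T = T * blockEquiv u₀ a₀) (m : ℕ)
    (p : U × (Fin k → L)) :
    blockEquiv (u ^ m) (a ^ m) (T p) = T (blockEquiv (u₀ ^ m) (a₀ ^ m) p) := by
  have hsc : SemiconjBy T (blockEquiv u₀ a₀) (blockEquiv u a) := h.symm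
  have := hsc.pow_right m
  rw [blockEquiv_pow, blockEquiv_pow] at this
  exact (LinearEquiv.congr_fun this p).symm

theorem fst_intertwiner_eq_zero (h : blockEquiv u a * T = T * blockEquiv u₀ a₀)
    (hu : u ^ N = 1) (ha₀ : ∀ i, a₀ i ^ N ≠ 1) (m : Fin k → L) : (T (0, m)).1 = 0 := by
  have hne : ∀ i, ((a₀ i : L) ^ N - 1) ≠ 0 := fun i h0 =>
    ha₀ i (Units.ext (by simpa using sub_eq_zero.1 h0))
  let m' : Fin k → L := fun i => m i / ((a₀ i : L) ^ N - 1)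
  have h1 := congrArg Prod.fst (blockEquiv_pow_intertwine h N (0, m'))
  rw [blockEquiv_apply, blockEquiv_apply, hu] at h1
  have h2 : ((0 : U), m) = (((u₀ ^ N) (0 : U), fun i => ((a₀ ^ N) i : L) * m' i) - (0, m')) := by
    ext i
    · simp
    · have := hne i
      simp only [m', Prod.snd_sub, Pi.sub_apply, Pi.pow_apply, Units.val_pow_eq_pow_val]
      field_simp
  rw [h2, map_sub, Prod.fst_sub, ← h1]
  simp

theorem snd_intertwiner_eq_zero (h : blockEquiv u a * T = T * blockEquiv u₀ a₀)
    (hu₀ : u₀ ^ N = 1) (ha : ∀ i, a i ^ N ≠ 1) (x : U) : (T (x, 0)).2 = 0 := by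
  ext i
  have h1 := congrFun (congrArg Prod.snd (blockEquiv_pow_intertwine h N (x, 0))) i
  rw [blockEquiv_apply, blockEquiv_apply, hu₀] at h1
  have h2 : (((1 : U ≃ₗ[F] U) x, fun i => ((a₀ ^ N) i : L) * (0 : Fin k → L) i) :
      U × (Fin k → L)) = (x, 0) := by
    ext i
    · simp
    · simp
  rw [h2] at h1
  by_contra h0
  have h3 : ((a ^ N) i : L) * (T (x, 0)).2 i = 1 * (T (x, 0)).2 i := by simpa using h1
  exact ha i (Units.ext (by simpa using mul_right_cancel₀ h0 h3))

/-- The block of `T` from the `j`-th to the `i`-th coordinate. -/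
def block (T : (U × (Fin k → L)) ≃ₗ[F] (U × (Fin k → L))) (i j : Fin k) : L →ₗ[F] L :=
  LinearMap.proj i ∘ₗ LinearMap.snd F U (Fin k → L) ∘ₗ (T : _ →ₗ[F] _) ∘ₗ
    LinearMap.inr F U (Fin k → L) ∘ₗ LinearMap.single F (fun _ => L) j

theorem mul_block_apply (h : blockEquiv u a * T = T * blockEquiv u₀ a₀) (i j : Fin k) (x : L) :
    (a i : L) * block T i j x = block T i j ((a₀ j : L) * x) := by
  have h1 := congrFun (congrArg Prod.snd (LinearEquiv.congr_fun h (0, Pi.single j x))) i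
  rw [LinearEquiv.mul_apply, LinearEquiv.mul_apply, blockEquiv_apply, blockEquiv_apply] at h1
  have h2 : (fun i => (a₀ i : L) * (Pi.single j x : Fin k → L) i) =
      Pi.single j ((a₀ j : L) * x) := by
    ext i
    by_cases hi : i = j
    · subst hi; simp
    · simp [Pi.single_eq_of_ne hi]
  rw [h2, map_zero] at h1
  exact h1

theorem snd_apply_eq_sum (p : U × (Fin k → L)) (i : Fin k) :
    (T p).2 i = (T (p.1, 0)).2 i + ∑ j, block T i j (p.2 j) := by
  have h : p = (p.1, 0) + ∑ j, (0, Pi.single j (p.2 j)) := by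
    ext i
    · simp [Prod.fst_sum]
    · simp [Prod.snd_sum, Finset.sum_apply, Pi.single_apply]
  conv_lhs => rw [h]
  rw [map_add, map_sum, Prod.snd_add, Prod.snd_sum, Pi.add_apply, Finset.sum_apply]
  rfl

variable [FiniteDimensional F L]

theorem exists_block_index (h : blockEquiv u a * T = T * blockEquiv u₀ a₀)
    (hu₀ : u₀ ^ N = 1) (ha : ∀ i, a i ^ N ≠ 1) (hinj : Function.Injective a₀)
    (hmin : ∀ i j, minpoly F (a i : L) = minpoly F (a₀ j : L) → a i = a₀ j) :
    ∃ j : Fin k → Fin k, (∀ i, a i = a₀ (j i)) ∧ ∀ i j', j' ≠ j i → block T i j' = 0 := by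
  have hex : ∀ i, ∃ j, block T i j ≠ 0 := by
    intro i
    by_contra! h0
    obtain ⟨p, hp⟩ := T.surjective (0, 1)
    have h1 := snd_apply_eq_sum (T := T) p i
    rw [hp, snd_intertwiner_eq_zero h hu₀ ha] at h1
    simp [h0] at h1
  choose j hj using hex
  have hja : ∀ i j, block T i j ≠ 0 → a i = a₀ j := fun i j hij =>
    hmin i j (minpoly_eq_of_intertwiner (mul_block_apply h i j) hij)
  refine ⟨j, fun i => hja i _ (hj i), fun i j' hj' => ?_⟩
  by_contra h0
  exact hj' (hinj ((hja i j' h0).symm.trans (hja i _ (hj i))))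

variable {R : Finset Lˣ}

theorem card_intertwiners_le [Finite F] [FiniteDimensional F U]
    {u : (Fin k → Lˣ) → U ≃ₗ[F] U} (hu : ∀ a, u a ^ N = 1)
    (hR : ∀ a ∈ R, a ^ N ≠ 1) (hR' : ∀ a ∈ R, Algebra.adjoin F {(a : L)} = ⊤)
    (hmin : ∀ a ∈ R, ∀ b ∈ R, minpoly F (a : L) = minpoly F (b : L) → a = b)
    (a₀ : Fin k ↪ R) :
    Nat.card {p : ((U × (Fin k → L)) ≃ₗ[F] (U × (Fin k → L))) × (Fin k ↪ R) //
      blockEquiv (u fun i => p.2 i) (fun i => (p.2 i : Lˣ)) * p.1 =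
        p.1 * blockEquiv (u fun i => a₀ i) (fun i => (a₀ i : Lˣ))} ≤
      Nat.card (U →ₗ[F] U) * (k * Nat.card L) ^ k := by
  have : Finite L := Module.finite_of_finite F
  have : Finite (U →ₗ[F] U) := Module.finite_of_finite F
  have hinj : Function.Injective fun i => (a₀ i : Lˣ) :=
    Subtype.val_injective.comp a₀.injective
  have hidx : ∀ p : {p : ((U × (Fin k → L)) ≃ₗ[F] (U × (Fin k → L))) × (Fin k ↪ R) //
      blockEquiv (u fun i => p.2 i) (fun i => (p.2 i : Lˣ)) * p.1 =
        p.1 * blockEquiv (u fun i => a₀ i) (fun i => (a₀ i : Lˣ))},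
      ∃ j : Fin k → Fin k, (∀ i, (p.1.2 i : Lˣ) = a₀ (j i)) ∧
        ∀ i j', j' ≠ j i → block p.1.1 i j' = 0 := fun p =>
    exists_block_index p.2 (hu _) (fun i => hR _ (p.1.2 i).2) hinj
      (fun i j => hmin _ (p.1.2 i).2 _ (a₀ j).2)
  choose j hj hj0 using hidx
  have hcard : Nat.card (U →ₗ[F] U) * (k * Nat.card L) ^ k =
      Nat.card ((U →ₗ[F] U) × (Fin k → Fin k × L)) := by
    simp [Nat.card_prod, Nat.card_fun]
  rw [hcard]
  refine Nat.card_le_card_of_injective (fun p => (LinearMap.fst F U (Fin k → L) ∘ₗ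
    (p.1.1 : _ →ₗ[F] _) ∘ₗ LinearMap.inl F U (Fin k → L),
    fun i => (j p i, block p.1.1 i (j p i) 1))) ?_
  intro p p' hpp
  simp only [Prod.mk.injEq] at hpp
  obtain ⟨h1, h2⟩ := hpp
  have hjj : j p = j p' := funext fun i => congrArg Prod.fst (congrFun h2 i)
  have h3 : ∀ i, block p.1.1 i (j p i) 1 = block p'.1.1 i (j p i) 1 := fun i => by
    have := congrArg Prod.snd (congrFun h2 i)
    simp only at this
    rw [this, hjj]
  have ha : ∀ i, p.1.2 i = p'.1.2 i := fun i => Subtype.ext (by rw [hj, hj, hjj])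
  have hblock : ∀ i j', block p.1.1 i j' = block p'.1.1 i j' := by
    intro i j'
    by_cases hj' : j' = j p i
    · subst hj'
      refine intertwiner_ext (hR' _ (a₀ (j p i)).2) (mul_block_apply p.2 i _) ?_ (h3 i)
      have := mul_block_apply p'.2 i (j p i)
      rw [← ha i] at this
      exact this
    · rw [hj0 p i j' hj', hj0 p' i j' (hjj ▸ hj')]
  have hfst : ∀ (q : {p : ((U × (Fin k → L)) ≃ₗ[F] (U × (Fin k → L))) × (Fin k ↪ R) //
      blockEquiv (u fun i => p.2 i) (fun i => (p.2 i : Lˣ)) * p.1 =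
        p.1 * blockEquiv (u fun i => a₀ i) (fun i => (a₀ i : Lˣ))}) (v : U × (Fin k → L)),
      (q.1.1 v).1 = (q.1.1 (v.1, 0)).1 := by
    intro q v
    have hv : v = (v.1, 0) + (0, v.2) := by simp
    conv_lhs => rw [hv]
    rw [map_add, Prod.fst_add, fst_intertwiner_eq_zero q.2 (hu _) (fun i => hR _ (a₀ i).2),
      add_zero]
  refine Subtype.ext (Prod.ext (LinearEquiv.ext fun v => Prod.ext ?_ (funext fun i => ?_))
    (DFunLike.ext _ _ ha))
  · rw [hfst p, hfst p']
    exact LinearMap.congr_fun h1 v.1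
  · rw [snd_apply_eq_sum (T := p.1.1) v, snd_apply_eq_sum (T := p'.1.1) v,
      snd_intertwiner_eq_zero p.2 (hu _) (fun i => hR _ (p.1.2 i).2),
      snd_intertwiner_eq_zero p'.2 (hu _) (fun i => hR _ (p'.1.2 i).2)]
    simp only [hblock]

end Blocks

section Representatives

theorem card_pow_card_eq_self_le {F L : Type*} [Field F] [Fintype F] [Field L] [Fintype L]
    [DecidableEq L] :
    (Finset.univ.filter fun x : L => x ^ Fintype.card F = x).card ≤ Fintype.card F := by
  have hq : 1 < Fintype.card F := Fintype.one_lt_card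
  have hne : (Polynomial.X ^ Fintype.card F - Polynomial.X : Polynomial L) ≠ 0 :=
    FiniteField.X_pow_card_sub_X_ne_zero L hq
  refine le_trans ?_ ((Multiset.toFinset_card_le _).trans
    ((Polynomial.card_roots' _).trans (FiniteField.X_pow_card_sub_X_natDegree_eq L hq).le))
  refine Finset.card_le_card fun x hx => ?_
  rw [Finset.mem_filter] at hx
  rw [Multiset.mem_toFinset, Polynomial.mem_roots hne]
  simp [hx.2]

variable {F L : Type*} [Field F] [Fintype F] [Field L] [Algebra F L] [FiniteDimensional F L]

/-- Representatives of the Galois orbits outside the base field, for extensions of prime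
degree. -/
theorem exists_orbit_representatives (hd : (finrank F L).Prime) :
    ∃ R : Finset Lˣ, (∀ a ∈ R, a ^ (Fintype.card F * (Fintype.card F - 1)) ≠ 1) ∧
      (∀ a ∈ R, Algebra.adjoin F {(a : L)} = ⊤) ∧
      (∀ a ∈ R, ∀ b ∈ R, minpoly F (a : L) = minpoly F (b : L) → a = b) ∧
      Fintype.card F ^ finrank F L ≤ finrank F L * R.card + Fintype.card F := by
  classical
  have : Finite L := Module.finite_of_finite F
  have : Fintype L := Fintype.ofFinite L
  have hq : 1 < Fintype.card F := Fintype.one_lt_card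
  let S : Finset Lˣ := Finset.univ.filter fun a : Lˣ => (a : L) ^ Fintype.card F ≠ a
  have hS : Fintype.card F ^ finrank F L ≤ S.card + Fintype.card F := by
    have h1 := Finset.card_filter_add_card_filter_not (s := Finset.univ)
      (fun x : L => x ^ Fintype.card F = x)
    rw [Finset.card_univ, Module.card_eq_pow_finrank (K := F) (V := L)] at h1
    have h2 := card_pow_card_eq_self_le (F := F) (L := L)
    have h3 : (Finset.univ.filter fun x : L => ¬ x ^ Fintype.card F = x).card ≤ S.card := by
      refine Finset.card_le_card_of_surjOn (fun a : Lˣ => (a : L)) ?_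
      intro x hx
      simp only [Finset.coe_filter, Finset.mem_univ, true_and, Set.mem_ofPred_eq] at hx
      have hx0 : x ≠ 0 := by
        rintro rfl
        exact hx (by simp)
      exact ⟨Units.mk0 x hx0, by simpa [S] using hx, rfl⟩
    omega
  let f : Lˣ → Polynomial F := fun a => minpoly F (a : L)
  obtain ⟨R, hRS, hRinj, hRim⟩ := Finset.exists_subset_injOn_image_eq_of_surjOn (f := f)
    (S : Set Lˣ) (S.image f) (by rw [Finset.coe_image]; exact Set.surjOn_image f _)
  have hRmem : ∀ a ∈ R, (a : L) ^ Fintype.card F ≠ a := fun a ha => by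
    simpa [S] using hRS ha
  have hRcard : R.card = (S.image f).card := by
    rw [← hRim, Finset.card_image_of_injOn hRinj]
  refine ⟨R, ?_, ?_, fun a ha b hb hab => hRinj ha hb hab, ?_⟩
  · intro a ha h
    refine hRmem a ha ?_
    have h1 : ((a : L) ^ (Fintype.card F - 1)) ^ Fintype.card F = 1 := by
      rw [← pow_mul, mul_comm]
      simpa using congrArg Units.val h
    have h2 : (a : L) ^ (Fintype.card F - 1) = 1 := by
      refine (FiniteField.frobeniusAlgHom F L).injective ?_
      simpa using h1
    calc (a : L) ^ Fintype.card F = (a : L) ^ (Fintype.card F - 1) * a := by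
          rw [← pow_succ, Nat.sub_add_cancel hq.le]
      _ = a := by rw [h2, one_mul]
  · intro a ha
    have := Subalgebra.isSimpleOrder_of_finrank_prime F L hd
    refine (eq_bot_or_eq_top _).resolve_left fun hbot => hRmem a ha ?_
    have hmem : (a : L) ∈ Algebra.adjoin F {(a : L)} := Algebra.self_mem_adjoin_singleton F _
    rw [hbot, Algebra.mem_bot] at hmem
    obtain ⟨c, hc⟩ := hmem
    rw [← hc, ← map_pow, FiniteField.pow_card]
  · have h1 : S.card ≤ finrank F L * (S.image f).card := by
      refine Finset.card_le_mul_card_image S _ fun P hP => ?_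
      obtain ⟨a, -, rfl⟩ := Finset.mem_image.1 hP
      have hintegral : IsIntegral F (a : L) := Algebra.IsIntegral.isIntegral _
      have hne : (minpoly F (a : L)).map (algebraMap F L) ≠ 0 :=
        (Polynomial.map_ne_zero_iff (algebraMap F L).injective).2 (minpoly.ne_zero hintegral)
      calc _ ≤ ((minpoly F (a : L)).map (algebraMap F L)).roots.toFinset.card := by
            refine Finset.card_le_card_of_injOn (fun b : Lˣ => (b : L)) ?_ Units.val_injective.injOn
            intro b hb
            have hb' : minpoly F (b : L) = minpoly F (a : L) := by
              simpa [f] using (Finset.mem_filter.1 hb).2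
            simp only [Finset.mem_coe, Multiset.mem_toFinset]
            rw [Polynomial.mem_roots hne, Polynomial.IsRoot.def, Polynomial.eval_map_algebraMap,
              ← hb', minpoly.aeval]
        _ ≤ _ := (Multiset.toFinset_card_le _).trans ((Polynomial.card_roots' _).trans
            ((Polynomial.natDegree_map_le).trans (minpoly.natDegree_le _)))
    rw [hRcard]
    omega

end Representatives

section Roots

variable {F V W : Type*} [Field F] [AddCommGroup V] [Module F V] [AddCommGroup W] [Module F W]

/-- Automorphisms of determinant `δ` whose `m`-th power differs from the identity by a map of
rank one. -/
def transvectionRoots (V : Type*) [AddCommGroup V] [Module F V] (m : ℕ) (δ : Fˣ) :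
    Set (V ≃ₗ[F] V) :=
  {g | LinearEquiv.det g = δ ∧ finrank F (LinearMap.range
    (((g ^ m : V ≃ₗ[F] V) : V →ₗ[F] V) - LinearMap.id)) = 1}

theorem conj_trans_pow (e : V ≃ₗ[F] W) (g : V ≃ₗ[F] V) (m : ℕ) :
    (e.symm ≪≫ₗ g ≪≫ₗ e) ^ m = e.symm ≪≫ₗ (g ^ m) ≪≫ₗ e := by
  induction m with
  | zero => ext; simp
  | succ m ih => rw [pow_succ, ih, pow_succ]; ext; simp

theorem conj_trans_mem_transvectionRoots (e : V ≃ₗ[F] W) {g : V ≃ₗ[F] V} {m : ℕ} {δ : Fˣ}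
    (hg : g ∈ transvectionRoots V m δ) : e.symm ≪≫ₗ g ≪≫ₗ e ∈ transvectionRoots W m δ := by
  refine ⟨(LinearEquiv.det_conj g e).trans hg.1, ?_⟩
  rw [conj_trans_pow, ← hg.2]
  have h : ((e.symm ≪≫ₗ (g ^ m) ≪≫ₗ e : W ≃ₗ[F] W) : W →ₗ[F] W) - LinearMap.id =
      (e : V →ₗ[F] W) ∘ₗ (((g ^ m : V ≃ₗ[F] V) : V →ₗ[F] V) - LinearMap.id) ∘ₗ
        (e.symm : W →ₗ[F] V) := by
    ext; simp
  rw [h, LinearMap.range_comp, LinearMap.range_comp_of_range_eq_top _ e.symm.range]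
  exact (LinearEquiv.finrank_eq (Submodule.equivMapOfInjective _ e.injective _)).symm

theorem conj_mem_transvectionRoots (h : V ≃ₗ[F] V) {g : V ≃ₗ[F] V} {m : ℕ} {δ : Fˣ}
    (hg : g ∈ transvectionRoots V m δ) : h * g * h⁻¹ ∈ transvectionRoots V m δ :=
  conj_trans_mem_transvectionRoots h hg

theorem card_transvectionRoots_congr (e : V ≃ₗ[F] W) (m : ℕ) (δ : Fˣ) :
    Nat.card (transvectionRoots V m δ) = Nat.card (transvectionRoots W m δ) := by
  refine Nat.card_congr ⟨fun g => ⟨_, conj_trans_mem_transvectionRoots e g.2⟩,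
    fun g => ⟨_, conj_trans_mem_transvectionRoots e.symm g.2⟩, fun g => ?_, fun g => ?_⟩
  · ext; simp
  · ext; simp

end Roots

section Count

variable {F L U : Type*} [Field F] [Field L] [Algebra F L] [AddCommGroup U] [Module F U] {k : ℕ}

theorem det_blockEquiv [FiniteDimensional F L] [FiniteDimensional F U] (u : U ≃ₗ[F] U)
    (a : Fin k → Lˣ) :
    LinearEquiv.det (blockEquiv u a) =
      LinearEquiv.det u * LinearEquiv.det (blockEquiv (1 : U ≃ₗ[F] U) a) := by
  have h : blockEquiv u a = blockEquiv u 1 * blockEquiv 1 a := by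
    ext p <;> simp [blockEquiv_apply]
  have h' : LinearEquiv.det (blockEquiv u (1 : Fin k → Lˣ)) = LinearEquiv.det u := by
    ext
    rw [LinearEquiv.coe_det, LinearEquiv.coe_det]
    have : ((blockEquiv u (1 : Fin k → Lˣ) : (U × (Fin k → L)) ≃ₗ[F] (U × (Fin k → L))) :
        (U × (Fin k → L)) →ₗ[F] (U × (Fin k → L))) =
        LinearMap.prodMap (u : U →ₗ[F] U) LinearMap.id := by
      ext p <;> simp [blockEquiv_apply]
    rw [this, LinearMap.det_prodMap, LinearMap.det_id, mul_one]
  rw [h, map_mul, h']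

theorem finrank_range_blockEquiv_one_sub_id (u : U ≃ₗ[F] U) :
    finrank F (LinearMap.range (((blockEquiv u (1 : Fin k → Lˣ) :
      (U × (Fin k → L)) ≃ₗ[F] (U × (Fin k → L))) :
        (U × (Fin k → L)) →ₗ[F] (U × (Fin k → L))) - LinearMap.id)) =
      finrank F (LinearMap.range ((u : U →ₗ[F] U) - LinearMap.id)) := by
  have h : ((blockEquiv u (1 : Fin k → Lˣ) : (U × (Fin k → L)) ≃ₗ[F] (U × (Fin k → L))) :
      (U × (Fin k → L)) →ₗ[F] (U × (Fin k → L))) - LinearMap.id =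
      LinearMap.inl F U (Fin k → L) ∘ₗ ((u : U →ₗ[F] U) - LinearMap.id) ∘ₗ
        LinearMap.fst F U (Fin k → L) := by
    ext p <;> simp [blockEquiv_apply]
  rw [h, LinearMap.range_comp, LinearMap.range_comp_of_range_eq_top _ (by simp)]
  exact (LinearEquiv.finrank_eq
    (Submodule.equivMapOfInjective _ LinearMap.inl_injective _)).symm

variable [FiniteDimensional F L] [Fintype F]

theorem card_mul_card_embedding_le {s : ℕ} (hs : 3 ≤ s) (δ : Fˣ) {R : Finset Lˣ}
    (hR : ∀ a ∈ R, a ^ (Fintype.card F * (Fintype.card F - 1)) ≠ 1)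
    (hR' : ∀ a ∈ R, Algebra.adjoin F {(a : L)} = ⊤)
    (hmin : ∀ a ∈ R, ∀ b ∈ R, minpoly F (a : L) = minpoly F (b : L) → a = b) :
    Nat.card (((Fin s → F) × (Fin k → L)) ≃ₗ[F] ((Fin s → F) × (Fin k → L))) *
      Nat.card (Fin k ↪ R) ≤
      Nat.card ((Fin s → F) →ₗ[F] (Fin s → F)) * (k * Nat.card L) ^ k *
        Nat.card (transvectionRoots (F := F) ((Fin s → F) × (Fin k → L))
          (Fintype.card F ^ finrank F L - 1) δ) := by
  classical
  have : Finite L := Module.finite_of_finite F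
  have : Fintype L := Fintype.ofFinite L
  have hLcard : Fintype.card L = Fintype.card F ^ finrank F L := Module.card_eq_pow_finrank
  have hfin : Finite (((Fin s → F) × (Fin k → L)) ≃ₗ[F] ((Fin s → F) × (Fin k → L))) :=
    DFunLike.finite _
  have : Fintype (((Fin s → F) × (Fin k → L)) ≃ₗ[F] ((Fin s → F) × (Fin k → L))) :=
    Fintype.ofFinite _
  have hm0 : ((Fintype.card F ^ finrank F L - 1 : ℕ) : F) ≠ 0 := by
    rw [Nat.cast_sub (Nat.one_le_pow _ _ Fintype.card_pos)]
    simp [finrank_pos.ne']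
  have hmdvd : Fintype.card F - 1 ∣ Fintype.card F ^ finrank F L - 1 := by
    simpa only [one_pow] using Nat.sub_dvd_pow_sub_pow (Fintype.card F) 1 (finrank F L)
  choose u hudet hupow hurank using fun a : Fin k → Lˣ => exists_transvection_mul_diagonal hs
    (δ * (LinearEquiv.det (blockEquiv (1 : (Fin s → F) ≃ₗ[F] (Fin s → F)) a))⁻¹)
  have hg : ∀ a : Fin k → Lˣ, blockEquiv (u a) a ∈
      transvectionRoots (F := F) ((Fin s → F) × (Fin k → L))
        (Fintype.card F ^ finrank F L - 1) δ := by
    intro a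
    refine ⟨by rw [det_blockEquiv, hudet, inv_mul_cancel_right], ?_⟩
    have ha : a ^ (Fintype.card F ^ finrank F L - 1) = 1 := by
      ext i
      rw [← hLcard]
      simpa using FiniteField.pow_card_sub_one_eq_one (a i : L) (a i).ne_zero
    rw [blockEquiv_pow, ha, finrank_range_blockEquiv_one_sub_id]
    exact hurank a _ hmdvd hm0
  let Φ : (((Fin s → F) × (Fin k → L)) ≃ₗ[F] ((Fin s → F) × (Fin k → L))) × (Fin k ↪ R) →
      (((Fin s → F) × (Fin k → L)) ≃ₗ[F] ((Fin s → F) × (Fin k → L))) := fun p =>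
    p.1 * blockEquiv (u fun i => p.2 i) (fun i => (p.2 i : Lˣ)) * p.1⁻¹
  have hfib := Finset.card_le_mul_card_image (f := Φ) Finset.univ
    (Nat.card ((Fin s → F) →ₗ[F] (Fin s → F)) * (k * Nat.card L) ^ k) (by
      intro b hb
      obtain ⟨⟨P₀, a₀⟩, -, rfl⟩ := Finset.mem_image.1 hb
      refine le_trans ?_ (card_intertwiners_le hupow hR hR' hmin a₀)
      rw [Nat.card_eq_fintype_card, Fintype.card_subtype]
      refine Finset.card_le_card_of_injOn (fun p => (p.1⁻¹ * P₀, p.2)) ?_ ?_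
      · intro p hp
        have hp' : Φ p = Φ (P₀, a₀) := (Finset.mem_filter.1 hp).2
        simp only [Φ] at hp'
        simp only [Finset.coe_filter, Finset.mem_univ, true_and, Set.mem_ofPred_eq]
        rw [mul_inv_eq_iff_eq_mul] at hp'
        rw [eq_inv_mul_of_mul_eq hp']
        group
      · intro p _ p' _ hpp
        simp only [Prod.mk.injEq, mul_left_inj, inv_inj] at hpp
        exact Prod.ext hpp.1 hpp.2)
  rw [Finset.card_univ, ← Nat.card_eq_fintype_card, Nat.card_prod] at hfib
  refine hfib.trans (Nat.mul_le_mul_left _ ?_)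
  rw [Nat.card_coe_set_eq, ← Set.ncard_coe_finset]
  refine Set.ncard_le_ncard ?_ (Set.toFinite _)
  intro g hg'
  simp only [Finset.coe_image, Finset.coe_univ, Set.image_univ] at hg'
  obtain ⟨p, rfl⟩ := hg'
  exact conj_mem_transvectionRoots _ (hg _)

/-- Roots of transvections are not too rare in any coset of the special linear group. -/
theorem card_le_mul_card_transvectionRoots {V : Type*} [AddCommGroup V] [Module F V]
    [FiniteDimensional F V] {s d : ℕ} (hs : 3 ≤ s) (hd : d.Prime)
    (hV : finrank F V = s + k * d)
    (hq : 2 * Fintype.card F + 2 * (d * k) ≤ Fintype.card F ^ d) (δ : Fˣ) :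
    Nat.card (V ≃ₗ[F] V) ≤ Fintype.card F ^ (s * s) * (2 * (d * k)) ^ k *
      Nat.card (transvectionRoots V (Fintype.card F ^ d - 1) δ) := by
  obtain ⟨p, hp⟩ := CharP.exists F
  have : Fact p.Prime := ⟨(CharP.char_is_prime_or_zero F p).resolve_right
    (CharP.char_ne_zero_of_finite F p)⟩
  have : NeZero d := ⟨hd.ne_zero⟩
  let L := FiniteField.Extension F p d
  have hL : finrank F L = d := FiniteField.finrank_extension F p d
  have : FiniteDimensional F L := FiniteDimensional.of_finrank_pos (hL.symm ▸ hd.pos)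
  have : Finite L := Module.finite_of_finite F
  have : Fintype L := Fintype.ofFinite L
  have : Finite ((Fin s → F) →ₗ[F] (Fin s → F)) := Module.finite_of_finite F
  have : Fintype ((Fin s → F) →ₗ[F] (Fin s → F)) := Fintype.ofFinite _
  obtain ⟨R, hR, hR', hmin, hRcard⟩ := exists_orbit_representatives (F := F) (L := L)
    (hL.symm ▸ hd)
  have hcount := card_mul_card_embedding_le (k := k) hs δ hR hR' hmin
  let e : V ≃ₗ[F] ((Fin s → F) × (Fin k → L)) := LinearEquiv.ofFinrankEq _ _ (by
    rw [hV, finrank_prod, finrank_fin_fun, finrank_pi_fintype]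
    simp [hL])
  have hcardV : Nat.card (V ≃ₗ[F] V) =
      Nat.card (((Fin s → F) × (Fin k → L)) ≃ₗ[F] ((Fin s → F) × (Fin k → L))) :=
    Nat.card_congr ⟨fun g => e.symm ≪≫ₗ g ≪≫ₗ e, fun g => e ≪≫ₗ g ≪≫ₗ e.symm,
      fun g => by ext; simp, fun g => by ext1; simp⟩
  have hLcard : Nat.card L = Fintype.card F ^ d := by
    rw [Nat.card_eq_fintype_card, Module.card_eq_pow_finrank (K := F), hL]
  have hEnd : Nat.card ((Fin s → F) →ₗ[F] (Fin s → F)) = Fintype.card F ^ (s * s) := by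
    rw [Nat.card_eq_fintype_card, Module.card_eq_pow_finrank (K := F), finrank_linearMap]
    simp
  rw [hL, ← card_transvectionRoots_congr e, ← hcardV, hLcard, hEnd] at hcount
  rw [hL] at hRcard
  have hemb : Fintype.card F ^ d ≤ 2 * d * (R.card + 1 - k) := by
    have h1 : 2 * d * R.card ≤ 2 * d * (R.card + 1 - k) + 2 * (d * k) := by
      rw [show 2 * (d * k) = 2 * d * k by ring, ← mul_add]
      exact Nat.mul_le_mul_left _ (by omega)
    have h2 : 2 * d * R.card = 2 * (d * R.card) := by ring
    omega
  have hemb' : (Fintype.card F ^ d) ^ k ≤ (2 * d) ^ k * Nat.card (Fin k ↪ R) := by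
    rw [Nat.card_eq_fintype_card, Fintype.card_embedding_eq, Fintype.card_fin, Fintype.card_coe]
    calc _ ≤ (2 * d * (R.card + 1 - k)) ^ k := Nat.pow_le_pow_left hemb k
      _ = (2 * d) ^ k * (R.card + 1 - k) ^ k := mul_pow _ _ _
      _ ≤ _ := Nat.mul_le_mul_left _ (Nat.pow_sub_le_descFactorial _ _)
  refine Nat.le_of_mul_le_mul_right ?_
    (pow_pos (pow_pos (Fintype.card_pos (α := F)) d) k)
  calc _ ≤ Nat.card (V ≃ₗ[F] V) * ((2 * d) ^ k * Nat.card (Fin k ↪ R)) :=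
        Nat.mul_le_mul_left _ hemb'
    _ = (2 * d) ^ k * (Nat.card (V ≃ₗ[F] V) * Nat.card (Fin k ↪ R)) := by ring
    _ ≤ (2 * d) ^ k * _ := Nat.mul_le_mul_left _ hcount
    _ = _ := by rw [mul_pow k, show 2 * (d * k) = 2 * d * k by ring, mul_pow (2 * d) k]; ring

end Count

section SecondMoment

variable {F V : Type*} [Field F] [AddCommGroup V] [Module F V]

/-- The `m`-th power differs from the identity by a map of rank one. -/
def PowIsRankOne (m : ℕ) (g : V ≃ₗ[F] V) : Prop :=
  finrank F (LinearMap.range (((g ^ m : V ≃ₗ[F] V) : V →ₗ[F] V) - LinearMap.id)) = 1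

theorem powIsRankOne_conj {m : ℕ} (g h : V ≃ₗ[F] V) :
    PowIsRankOne m (h * g * h⁻¹) ↔ PowIsRankOne m g := by
  constructor
  · intro hg
    have := (conj_mem_transvectionRoots (δ := LinearEquiv.det (h * g * h⁻¹)) h⁻¹ ⟨rfl, hg⟩).2
    rwa [show h⁻¹ * (h * g * h⁻¹) * h⁻¹⁻¹ = g by group] at this
  · intro hg
    exact (conj_mem_transvectionRoots (δ := LinearEquiv.det g) h ⟨rfl, hg⟩).2

variable [Fintype F] [FiniteDimensional F V] [Fintype (V ≃ₗ[F] V)]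

open Classical in
theorem card_forall_not_powIsRankOne_mul_le {m e b : ℕ} {M : ℝ}
    (hM : ∀ δ : Fˣ, (Fintype.card (V ≃ₗ[F] V) : ℝ) ≤ M * Nat.card (transvectionRoots V m δ))
    (hb : b ≠ 0) (heb : e + 5 * b ≤ finrank F V) (hb' : 10 * b ≤ finrank F V)
    {ι : Type*} [Fintype ι] {u : ι → V ≃ₗ[F] V}
    (hu : ∀ i j, i ≠ j → EigenspacesLE e (u i * (u j)⁻¹)) :
    ((Finset.univ.filter fun z : V ≃ₗ[F] V => ∀ i, ¬ PowIsRankOne m (u i * z)).card : ℝ) *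
        Fintype.card ι ^ 2 ≤
      M ^ 2 * (Fintype.card ι + Fintype.card ι ^ 2 *
        (64 * finrank F V / √(Fintype.card F ^ b))) * Fintype.card (V ≃ₗ[F] V) := by
  set lam : ℝ := 64 * finrank F V / √(Fintype.card F ^ b)
  have hlam : 0 ≤ lam := by positivity
  let X : Fˣ → Finset (V ≃ₗ[F] V) := fun δ => Finset.univ.filter fun x => LinearEquiv.det x = δ
  let A : Fˣ → Finset (V ≃ₗ[F] V) := fun δ => (X δ).filter fun x => PowIsRankOne m x
  have hAcard : ∀ δ, (A δ).card = Nat.card (transvectionRoots V m δ) := by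
    intro δ
    rw [Nat.card_eq_fintype_card, ← Set.toFinset_card]
    congr 1
    ext g
    rw [Set.mem_toFinset]
    exact ⟨fun h => ⟨(Finset.mem_filter.1 (Finset.mem_filter.1 h).1).2, (Finset.mem_filter.1 h).2⟩,
      fun h => Finset.mem_filter.2 ⟨Finset.mem_filter.2 ⟨Finset.mem_univ _, h.1⟩, h.2⟩⟩
  let μ : Fˣ → ℝ := fun δ => (A δ).card / (X δ).card
  have hμ0 : ∀ δ, 0 ≤ μ δ := fun δ => by positivity
  have hμ1 : ∀ δ, μ δ ≤ 1 := fun δ =>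
    div_le_one_of_le₀ (by exact_mod_cast Finset.card_filter_le _ _) (by positivity)
  have hΓ : (0 : ℝ) < Fintype.card (V ≃ₗ[F] V) := by exact_mod_cast Fintype.card_pos
  have hApos : ∀ δ, (0 : ℝ) < (A δ).card := by
    intro δ
    have h := hM δ
    rw [← hAcard] at h
    rcases (Nat.cast_nonneg (α := ℝ) (A δ).card).eq_or_lt with h0 | h0
    · rw [← h0, mul_zero] at h
      linarith
    · exact h0
  have hM0 : 0 < M := by
    have h := hM 1
    rw [← hAcard] at h
    by_contra hneg
    have := mul_nonpos_of_nonpos_of_nonneg (not_lt.1 hneg) (hApos 1).le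
    linarith
  have hμM : ∀ δ, 1 ≤ M * μ δ := by
    intro δ
    have h := hM δ
    rw [← hAcard] at h
    have h1 : ((X δ).card : ℝ) ≤ Fintype.card (V ≃ₗ[F] V) := by
      exact_mod_cast Finset.card_le_univ _
    have h2 : (0 : ℝ) < (X δ).card :=
      (hApos δ).trans_le (by exact_mod_cast Finset.card_filter_le _ _)
    simp only [μ]
    rw [← mul_div_assoc, le_div_iff₀ h2, one_mul]
    linarith
  let f : (V ≃ₗ[F] V) → ℝ := fun x => (if PowIsRankOne m x then 1 else 0) - μ (LinearEquiv.det x)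
  have hconj : ∀ g h, f (h * g * h⁻¹) = f g := by
    intro g h
    have hdet : LinearEquiv.det (h * g * h⁻¹) = LinearEquiv.det g := by
      rw [map_mul, map_mul, map_inv, mul_right_comm, mul_inv_cancel, one_mul]
    simp only [f, hdet, powIsRankOne_conj]
  have hsum : ∀ δ : Fˣ, ∑ x with LinearEquiv.det x = δ, f x = 0 := by
    intro δ
    have h1 : ∑ x ∈ X δ, f x = ∑ x ∈ X δ, ((if PowIsRankOne m x then (1 : ℝ) else 0) - μ δ) :=
      Finset.sum_congr rfl fun x hx => by simp only [f, (Finset.mem_filter.1 hx).2]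
    refine h1.trans ?_
    rw [Finset.sum_sub_distrib, Finset.sum_const, ← Finset.sum_filter, Finset.sum_const,
      nsmul_eq_mul, nsmul_eq_mul, mul_one]
    change ((A δ).card : ℝ) - (X δ).card * ((A δ).card / (X δ).card) = 0
    have h2 : (0 : ℝ) < (X δ).card :=
      (hApos δ).trans_le (by exact_mod_cast Finset.card_filter_le _ _)
    field_simp
    ring
  have hf2 : ∑ x, f x ^ 2 ≤ Fintype.card (V ≃ₗ[F] V) := by
    have : ∀ x ∈ Finset.univ, f x ^ 2 ≤ 1 := by
      intro x _
      rw [sq_le_one_iff_abs_le_one, abs_le]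
      have h0 := hμ0 (LinearEquiv.det x)
      have h1 := hμ1 (LinearEquiv.det x)
      simp only [f]
      split_ifs <;> constructor <;> linarith
    refine (Finset.sum_le_sum this).trans ?_
    simp
  have hterm : ∀ i j, ∑ z, f (u i * z) * f (u j * z) ≤
      ((if i = j then 1 else 0) + lam) * Fintype.card (V ≃ₗ[F] V) := by
    intro i j
    have hre : ∑ z, f (u i * z) * f (u j * z) = ∑ x, f x * f ((u i * (u j)⁻¹)⁻¹ * x) := by
      refine Fintype.sum_equiv (Equiv.mulLeft (u i)) _ _ fun z => ?_
      simp [mul_assoc]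
    rw [hre]
    have hnn : 0 ≤ ∑ x, f x ^ 2 := Finset.sum_nonneg fun _ _ => sq_nonneg _
    by_cases hij : i = j
    · subst hij
      simp only [mul_inv_cancel, inv_one, one_mul, if_true, ← pow_two]
      nlinarith
    · rw [if_neg hij, zero_add]
      refine (le_abs_self _).trans ((abs_sum_mul_translate_le hconj hsum (hu i j hij) hb heb
        hb').trans ?_)
      exact mul_le_mul_of_nonneg_left hf2 hlam
  have htotal : ∑ z, (∑ i, f (u i * z)) ^ 2 ≤
      (Fintype.card ι + Fintype.card ι ^ 2 * lam) * Fintype.card (V ≃ₗ[F] V) := by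
    calc ∑ z, (∑ i, f (u i * z)) ^ 2 = ∑ i, ∑ j, ∑ z, f (u i * z) * f (u j * z) := by
          simp only [pow_two, Finset.sum_mul_sum]
          rw [Finset.sum_comm]
          exact Finset.sum_congr rfl fun i _ => Finset.sum_comm
      _ ≤ ∑ i : ι, ∑ j : ι, ((if i = j then 1 else 0) + lam) * Fintype.card (V ≃ₗ[F] V) :=
          Finset.sum_le_sum fun i _ => Finset.sum_le_sum fun j _ => hterm i j
      _ = _ := by
          simp only [← Finset.sum_mul, Finset.sum_add_distrib, Finset.sum_ite_eq,
            Finset.mem_univ, if_true, Finset.sum_const, Finset.card_univ, nsmul_eq_mul, mul_one]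
          ring
  have hfail : ∀ z ∈ Finset.univ.filter fun z : V ≃ₗ[F] V => ∀ i, ¬ PowIsRankOne m (u i * z),
      (Fintype.card ι : ℝ) ^ 2 ≤ M ^ 2 * (∑ i, f (u i * z)) ^ 2 := by
    intro z hz
    have hz' := (Finset.mem_filter.1 hz).2
    have h1 : (Fintype.card ι : ℝ) ≤ M * -∑ i, f (u i * z) := by
      rw [← Finset.sum_neg_distrib, Finset.mul_sum]
      calc (Fintype.card ι : ℝ) = ∑ i : ι, 1 := by simp
        _ ≤ _ := Finset.sum_le_sum fun i _ => by
            simpa [f, hz' i] using hμM _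
    calc (Fintype.card ι : ℝ) ^ 2 ≤ (M * -∑ i, f (u i * z)) ^ 2 :=
          pow_le_pow_left₀ (by positivity) h1 2
      _ = _ := by ring
  calc _ ≤ ∑ z ∈ Finset.univ.filter fun z : V ≃ₗ[F] V => ∀ i, ¬ PowIsRankOne m (u i * z),
        M ^ 2 * (∑ i, f (u i * z)) ^ 2 := by
        rw [← nsmul_eq_mul]
        exact Finset.card_nsmul_le_sum _ _ _ hfail
    _ ≤ ∑ z, M ^ 2 * (∑ i, f (u i * z)) ^ 2 :=
        Finset.sum_le_univ_sum_of_nonneg fun z => by positivity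
    _ = M ^ 2 * ∑ z, (∑ i, f (u i * z)) ^ 2 := by rw [Finset.mul_sum]
    _ ≤ M ^ 2 * ((Fintype.card ι + Fintype.card ι ^ 2 * lam) * Fintype.card (V ≃ₗ[F] V)) := by
        gcongr
    _ = _ := by ring

end SecondMoment

section BadTriples

variable {F V : Type*} [Field F] [Fintype F] [AddCommGroup V] [Module F V]
  [Fintype (V ≃ₗ[F] V)] {H : Subgroup (V ≃ₗ[F] V)} [Fintype H]

open Classical in
theorem card_le_card_mul_of_det_one_mem
    (hH : ∀ g : V ≃ₗ[F] V, LinearEquiv.det g = 1 → g ∈ H) :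
    Fintype.card (V ≃ₗ[F] V) ≤ Fintype.card F * Fintype.card H := by
  have h1 : ∀ δ ∈ (Finset.univ : Finset Fˣ),
      (Finset.univ.filter fun g : V ≃ₗ[F] V => LinearEquiv.det g = δ).card ≤ Fintype.card H := by
    intro δ _
    rcases (Finset.univ.filter fun g : V ≃ₗ[F] V =>
      LinearEquiv.det g = δ).eq_empty_or_nonempty with h | ⟨g₀, hg₀⟩
    · simp [h]
    · have hg₀ := (Finset.mem_filter.1 hg₀).2
      rw [← Fintype.card_coe]
      refine Fintype.card_le_of_injective (fun g => ⟨g.1 * g₀⁻¹, hH _ ?_⟩) ?_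
      · rw [map_mul, map_inv, hg₀, (Finset.mem_filter.1 g.2).2, mul_inv_cancel]
      · intro g g' h
        exact Subtype.ext (mul_right_cancel (Subtype.ext_iff.1 h))
  calc Fintype.card (V ≃ₗ[F] V)
      = ∑ δ : Fˣ, (Finset.univ.filter fun g : V ≃ₗ[F] V => LinearEquiv.det g = δ).card :=
        Finset.card_eq_sum_card_fiberwise fun _ _ => Finset.mem_coe.2 (Finset.mem_univ _)
    _ ≤ ∑ _δ : Fˣ, Fintype.card H := Finset.sum_le_sum h1
    _ = Fintype.card Fˣ * Fintype.card H := by simp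
    _ ≤ _ := Nat.mul_le_mul_right _
        (Fintype.card_le_of_injective (fun a : Fˣ => (a : F)) Units.val_injective)

variable [FiniteDimensional F V]

open Classical in
theorem card_forall_word_not_powIsRankOne_le
    (hH : ∀ g : V ≃ₗ[F] V, LinearEquiv.det g = 1 → g ∈ H) {m e b ℓ : ℕ} {M : ℝ}
    (hM : ∀ δ : Fˣ, (Fintype.card (V ≃ₗ[F] V) : ℝ) ≤ M * Nat.card (transvectionRoots V m δ))
    (hb : b ≠ 0) (heb : e + 5 * b ≤ finrank F V) (hb' : 10 * b ≤ finrank F V)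
    (hℓ : 2 * ℓ + 1 ≤ finrank F V) :
    ((Finset.univ.filter fun p : (Bool → H) × H => ∀ w : Fin ℓ → Bool,
        ¬ PowIsRankOne m
          (wordEval (fun i => (p.1 i : V ≃ₗ[F] V)) (List.ofFn w) * (p.2 : V ≃ₗ[F] V))).card : ℝ) ≤
      (2 ^ ℓ * 2 ^ ℓ * (4 * ℓ * Fintype.card F ^ (2 * ℓ)) / Fintype.card F ^ e +
        Fintype.card F * (M ^ 2 * (1 / 2 ^ ℓ + 64 * finrank F V / √(Fintype.card F ^ b)))) *
        Fintype.card H ^ 3 := by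
  set q : ℝ := ((Fintype.card F : ℕ) : ℝ) with hq
  set N : ℝ := ((Fintype.card H : ℕ) : ℝ) with hN
  have hq0 : 0 < q := by
    rw [hq]
    exact_mod_cast Fintype.card_pos
  let ev : (Bool → H) → (Fin ℓ → Bool) → V ≃ₗ[F] V := fun x w =>
    wordEval (fun i => (x i : V ≃ₗ[F] V)) (List.ofFn w)
  let D : (Fin ℓ → Bool) × (Fin ℓ → Bool) → Finset (Bool → H) := fun p =>
    if p.1 = p.2 then ∅ else
      Finset.univ.filter fun x => ¬ EigenspacesLE e (ev x p.1 * (ev x p.2)⁻¹)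
  let B : Finset (Bool → H) := Finset.univ.biUnion D
  have hD : ∀ p ∈ (Finset.univ : Finset ((Fin ℓ → Bool) × (Fin ℓ → Bool))),
      ((D p).card : ℝ) ≤ 4 * ℓ * q ^ (2 * ℓ) / q ^ e * N ^ 2 := by
    intro p _
    by_cases hp : p.1 = p.2
    · simp only [D, if_pos hp, Finset.card_empty, Nat.cast_zero]
      positivity
    · simp only [D, if_neg hp]
      have := card_not_eigenspacesLE_mul_le hH (w := List.ofFn p.1) (w' := List.ofFn p.2)
        (List.length_ofFn) (List.length_ofFn) (fun h => hp (List.ofFn_injective h)) hℓ e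
      rw [div_mul_eq_mul_div, le_div_iff₀ (by positivity)]
      rw [hq, hN]
      exact_mod_cast this
  have hB : (B.card : ℝ) ≤ 2 ^ ℓ * 2 ^ ℓ * (4 * ℓ * q ^ (2 * ℓ)) / q ^ e * N ^ 2 := by
    calc (B.card : ℝ) ≤ ∑ p, ((D p).card : ℝ) := by exact_mod_cast Finset.card_biUnion_le
      _ ≤ ∑ _p : (Fin ℓ → Bool) × (Fin ℓ → Bool), 4 * ℓ * q ^ (2 * ℓ) / q ^ e * N ^ 2 :=
          Finset.sum_le_sum hD
      _ = _ := by
          simp only [Finset.sum_const, Finset.card_univ, Fintype.card_prod, Fintype.card_fun,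
            Fintype.card_bool, Fintype.card_fin, nsmul_eq_mul, Nat.cast_mul, Nat.cast_pow,
            Nat.cast_ofNat]
          ring
  set T : ℝ := q * (M ^ 2 * (1 / 2 ^ ℓ + 64 * finrank F V / √(q ^ b))) with hT
  have hT0 : 0 ≤ T := by positivity
  let Z : (Bool → H) → Finset H := fun x =>
    Finset.univ.filter fun z => ∀ w, ¬ PowIsRankOne m (ev x w * (z : V ≃ₗ[F] V))
  have hZ : ∀ x ∉ B, ((Z x).card : ℝ) ≤ T * N := by
    intro x hx
    have hu : ∀ i j, i ≠ j → EigenspacesLE e (ev x i * (ev x j)⁻¹) := by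
      intro i j hij
      by_contra h
      refine hx (Finset.mem_biUnion.2 ⟨(i, j), Finset.mem_univ _, ?_⟩)
      simp only [D, if_neg hij]
      exact Finset.mem_filter.2 ⟨Finset.mem_univ _, h⟩
    have h1 := card_forall_not_powIsRankOne_mul_le hM hb heb hb' hu
    have h2 : ((Z x).card : ℝ) ≤ ((Finset.univ.filter fun z : V ≃ₗ[F] V =>
        ∀ i, ¬ PowIsRankOne m (ev x i * z)).card : ℝ) := by
      norm_cast
      refine Finset.card_le_card_of_injOn (fun z => (z : V ≃ₗ[F] V)) (fun z hz => ?_)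
        (Subtype.val_injective.injOn)
      exact Finset.mem_coe.2 (Finset.mem_filter.2
        ⟨Finset.mem_univ _, (Finset.mem_filter.1 (Finset.mem_coe.1 hz)).2⟩)
    have h3 : (Fintype.card (V ≃ₗ[F] V) : ℝ) ≤ q * N := by
      rw [hq, hN]
      exact_mod_cast card_le_card_mul_of_det_one_mem hH
    have hcard : (Fintype.card (Fin ℓ → Bool) : ℝ) = 2 ^ ℓ := by simp
    rw [hcard, ← le_div_iff₀ (by positivity)] at h1
    refine h2.trans (h1.trans ?_)
    rw [div_le_iff₀ (by positivity)]
    calc _ ≤ M ^ 2 * (2 ^ ℓ + (2 ^ ℓ) ^ 2 * (64 * finrank F V / √(q ^ b))) * (q * N) := by gcongr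
      _ = T * N * (2 ^ ℓ) ^ 2 := by
          rw [hT]
          field_simp
  calc _ = ∑ x, ((Z x).card : ℝ) := by
        norm_cast
        rw [← Finset.card_sigma]
        refine Finset.card_bij (fun p _ => ⟨p.1, p.2⟩) ?_ ?_ ?_
        · intro p hp
          exact Finset.mem_sigma.2 ⟨Finset.mem_univ _,
            Finset.mem_filter.2 ⟨Finset.mem_univ _, (Finset.mem_filter.1 hp).2⟩⟩
        · rintro ⟨x, z⟩ _ ⟨x', z'⟩ _ h
          cases h
          rfl
        · rintro ⟨x, z⟩ hp
          exact ⟨(x, z), Finset.mem_filter.2 ⟨Finset.mem_univ _,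
            (Finset.mem_filter.1 (Finset.mem_sigma.1 hp).2).2⟩, rfl⟩
    _ ≤ ∑ x : Bool → H, ((if x ∈ B then N else 0) + T * N) := by
        refine Finset.sum_le_sum fun x _ => ?_
        by_cases hx : x ∈ B
        · rw [if_pos hx]
          have : ((Z x).card : ℝ) ≤ N := by
            rw [hN]
            exact_mod_cast Finset.card_le_univ _
          have : 0 ≤ T * N := by positivity
          linarith
        · rw [if_neg hx, zero_add]
          exact hZ x hx
    _ = B.card * N + N ^ 2 * (T * N) := by
        rw [Finset.sum_add_distrib, Finset.sum_ite_mem, Finset.univ_inter]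
        simp [hN]
    _ ≤ (2 ^ ℓ * 2 ^ ℓ * (4 * ℓ * q ^ (2 * ℓ)) / q ^ e * N ^ 2) * N + N ^ 2 * (T * N) := by
        gcongr
    _ = _ := by ring

end BadTriples

section Parameters

open Real

variable {q n : ℕ}

theorem log_estimates (hq : 2 ≤ q) (hn : 2 ≤ n)
    (h : log q < 1 / 10 ^ 10 * n / log n ^ 2) :
    0.69 ≤ log q ∧ 0.69 ≤ log n ∧ log q * log n ^ 2 ≤ n / 10 ^ 10 ∧
      log q ≤ n / 10 ^ 9 ∧ log n ≤ n / 10 ^ 9 ∧ (10 : ℝ) ^ 9 ≤ n := by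
  have h2 := log_two_gt_d9
  have hQ : 0.69 ≤ log q := by
    have : log 2 ≤ log q := log_le_log (by norm_num) (by exact_mod_cast hq)
    linarith
  have hL : 0.69 ≤ log n := by
    have : log 2 ≤ log n := log_le_log (by norm_num) (by exact_mod_cast hn)
    linarith
  have hQL : log q * log n ^ 2 ≤ n / 10 ^ 10 := by
    rw [lt_div_iff₀ (by positivity)] at h
    linarith
  refine ⟨hQ, hL, hQL, ?_, ?_, ?_⟩ <;> nlinarith [mul_le_mul hL hL (by norm_num) (by linarith),
    mul_le_mul hQ hL (by norm_num) (by linarith)]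

theorem exists_parameters (hq : 2 ≤ q) (hn : 2 ≤ n)
    (h : log q < 1 / 10 ^ 10 * n / log n ^ 2) :
    ∃ d k s : ℕ, 3 ≤ s ∧ d.Prime ∧ n = s + k * d ∧ 2 * q + 2 * (d * k) ≤ q ^ d ∧
      (((q ^ d - 1) * (n / 32 + 1) : ℕ) : ℝ) ≤ (n : ℝ) ^ (1605 * log q) ∧
      (q : ℝ) ^ (s * s) * (2 * (d * k)) ^ k ≤ exp (n / 300) := by
  obtain ⟨hQ, hL, hQL, -, -, hn9⟩ := log_estimates hq hn h
  have hn3 : 3 ≤ n := by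
    have : (3 : ℝ) ≤ n := le_trans (by norm_num) hn9
    exact_mod_cast this
  have hn0 : (0 : ℝ) < n := by positivity
  have hq0 : (0 : ℝ) < q := by positivity
  obtain ⟨d, hd, hlt, hle⟩ := Nat.exists_prime_lt_and_le_two_mul ⌈800 * log n⌉₊
    (Nat.ceil_pos.2 (by positivity)).ne'
  have hceil := Nat.le_ceil (800 * log n)
  have hceil' := Nat.ceil_lt_add_one (a := 800 * log n) (by positivity)
  have hlt' : 800 * log n ≤ (d - 1 : ℕ) := hceil.trans (by exact_mod_cast Nat.le_sub_one_of_lt hlt)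
  have hlt'' : 800 * log n ≤ d := hlt'.trans (by exact_mod_cast Nat.sub_le _ _)
  have hle' : (d : ℝ) ≤ 1603 * log n := by
    have : (d : ℝ) ≤ 2 * ⌈800 * log n⌉₊ := by exact_mod_cast hle
    linarith
  have hmod := Nat.mod_lt (n - 3) hd.pos
  have hdm := Nat.div_add_mod (n - 3) d
  set k := (n - 3) / d
  have hs : (((n - 3) % d + 3 : ℕ) : ℝ) ≤ 1607 * log n := by
    have : (((n - 3) % d + 3 : ℕ) : ℝ) ≤ d + 2 := by
      exact_mod_cast (by omega)
    linarith
  set s := (n - 3) % d + 3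
  have hdk : d * k ≤ n := by omega
  have hdk' : (d : ℝ) * k ≤ n := by exact_mod_cast hdk
  have hexp : ∀ m : ℕ, (q : ℝ) ^ m = exp (m * log q) := by
    intro m
    rw [exp_nat_mul, exp_log hq0]
  refine ⟨d, k, s, Nat.le_add_left _ _, hd, by rw [mul_comm k]; omega, ?_, ?_, ?_⟩
  · have h1 : 2 * n ≤ q ^ (d - 1) := by
      have : (2 * n : ℝ) ≤ q ^ (d - 1) := by
        calc (2 * n : ℝ) ≤ n * n := by gcongr; exact_mod_cast hn
          _ = exp (log n + log n) := by rw [exp_add, exp_log hn0]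
          _ ≤ exp ((d - 1 : ℕ) * log q) := exp_le_exp.2 (by nlinarith)
          _ = _ := (hexp _).symm
      exact_mod_cast this
    have h2 : q ^ d = q ^ (d - 1) * q := by
      rw [← pow_succ, Nat.sub_add_cancel hd.pos]
    rw [h2]
    nlinarith [Nat.mul_le_mul_right q h1]
  · have h1 : (((q ^ d - 1) * (n / 32 + 1) : ℕ) : ℝ) ≤ q ^ d * n := by
      exact_mod_cast Nat.mul_le_mul (Nat.sub_le _ _) (by omega)
    refine h1.trans ?_
    rw [hexp, rpow_def_of_pos hn0]
    nth_rewrite 1 [← exp_log hn0]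
    rw [← exp_add]
    refine exp_le_exp.2 ?_
    nlinarith
  · have h1 : (2 * (d * k) : ℝ) ^ k ≤ exp (k * (2 * log n)) := by
      rw [exp_nat_mul, two_mul (log n), exp_add, exp_log hn0]
      gcongr
      exact_mod_cast hn
    have h2 : (k : ℝ) * (2 * log n) ≤ n / 400 := by nlinarith
    have h3 : ((s * s : ℕ) : ℝ) * log q ≤ 1607 ^ 2 * (n / 10 ^ 10) := by
      have h4 : ((s * s : ℕ) : ℝ) ≤ 1607 ^ 2 * log n ^ 2 := by
        push_cast
        nlinarith [Nat.cast_nonneg (α := ℝ) s]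
      nlinarith
    calc _ ≤ exp ((s * s : ℕ) * log q) * exp (k * (2 * log n)) := by
          rw [hexp]
          gcongr
      _ ≤ _ := by
          rw [← exp_add]
          exact exp_le_exp.2 (by linarith)

theorem failure_bound_le (hq : 2 ≤ q) (hn : 2 ≤ n)
    (h : log q < 1 / 10 ^ 10 * n / log n ^ 2) {M : ℝ} (hM0 : 0 ≤ M) (hM : M ≤ exp (n / 300)) :
    2 ^ (n / 32) * 2 ^ (n / 32) * (4 * (n / 32 : ℕ) * (q : ℝ) ^ (2 * (n / 32))) / q ^ (n / 2) +
        q * (M ^ 2 * (1 / 2 ^ (n / 32) + 64 * n / √(q ^ (n / 10)))) ≤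
      exp (-(1 / 10 ^ 10) * n) := by
  obtain ⟨hQ, hL, -, hQn, hLn, hn9⟩ := log_estimates hq hn h
  have hl2 := log_two_gt_d9
  have hl2' := log_two_lt_d9
  have hn0 : (0 : ℝ) < n := by positivity
  have hq0 : (0 : ℝ) < q := by positivity
  have hexp : ∀ m : ℕ, (q : ℝ) ^ m = exp (m * log q) := by
    intro m
    rw [exp_nat_mul, exp_log hq0]
  have hexp2 : ∀ m : ℕ, (2 : ℝ) ^ m = exp (m * log 2) := by
    intro m
    rw [exp_nat_mul, exp_log two_pos]
  have hnexp : (n : ℝ) = exp (log n) := (exp_log hn0).symm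
  have hQ2 : log 2 ≤ log q := log_le_log (by norm_num) (by exact_mod_cast hq)
  have hℓ1 : ((n / 32 : ℕ) : ℝ) ≤ n / 32 := Nat.cast_div_le
  have hℓ2 : (n : ℝ) / 32 - 1 ≤ (n / 32 : ℕ) := by
    have : (n : ℝ) ≤ 32 * (n / 32 : ℕ) + 32 := by exact_mod_cast (by omega)
    linarith
  have he : (n : ℝ) / 2 - 1 ≤ (n / 2 : ℕ) := by
    have : (n : ℝ) ≤ 2 * (n / 2 : ℕ) + 2 := by exact_mod_cast (by omega)
    linarith
  have hb : (n : ℝ) / 10 - 1 ≤ (n / 10 : ℕ) := by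
    have : (n : ℝ) ≤ 10 * (n / 10 : ℕ) + 10 := by exact_mod_cast (by omega)
    linarith
  set ℓ := n / 32
  have hM2 : M ^ 2 ≤ exp (n / 150) := by
    calc M ^ 2 ≤ exp (n / 300) ^ 2 := pow_le_pow_left₀ hM0 hM 2
      _ = _ := by
        rw [← exp_nat_mul]
        congr 1
        push_cast
        ring
  have hqexp : (q : ℝ) = exp (log q) := (exp_log hq0).symm
  have T1 : 2 ^ ℓ * 2 ^ ℓ * (4 * ℓ * (q : ℝ) ^ (2 * ℓ)) / q ^ (n / 2) ≤ exp (-n / 100) := by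
    rw [div_le_iff₀ (by positivity), hexp, hexp, hexp2]
    calc _ ≤ exp (ℓ * log 2) * exp (ℓ * log 2) * (exp (log n) * exp ((2 * ℓ : ℕ) * log q)) := by
          gcongr
          rw [← hnexp]
          linarith
      _ ≤ _ := by
          rw [← exp_add, ← exp_add, ← exp_add, ← exp_add]
          refine exp_le_exp.2 ?_
          push_cast
          nlinarith
  have T2 : q * (M ^ 2 * (1 / 2 ^ ℓ)) ≤ exp (-n / 100) := by
    rw [← mul_assoc, mul_one_div, div_le_iff₀ (by positivity), hexp2]
    calc _ ≤ exp (log q) * exp (n / 150) := by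
          rw [← hqexp]
          gcongr
      _ ≤ _ := by
          rw [← exp_add, ← exp_add]
          refine exp_le_exp.2 ?_
          nlinarith
  have T3 : q * (M ^ 2 * (64 * n / √(q ^ (n / 10)))) ≤ exp (-n / 100) := by
    have hsqrt : √((q : ℝ) ^ (n / 10)) = exp ((n / 10 : ℕ) * log q / 2) := by
      rw [hexp, exp_half]
    have h64 : (64 : ℝ) = exp (6 * log 2) := by
      rw [show (6 : ℝ) = (6 : ℕ) by norm_num, ← hexp2]
      norm_num
    rw [← mul_div_assoc, ← mul_div_assoc, div_le_iff₀ (by positivity), hsqrt]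
    calc _ ≤ exp (log q) * (exp (n / 150) * (exp (6 * log 2) * exp (log n))) := by
          rw [← hqexp, ← h64, ← hnexp]
          gcongr
      _ ≤ _ := by
          rw [← exp_add, ← exp_add, ← exp_add, ← exp_add]
          refine exp_le_exp.2 ?_
          nlinarith
  have h3 : 3 * exp (-n / 100) ≤ exp (-(1 / 10 ^ 10) * n) := by
    calc 3 * exp (-n / 100) ≤ exp 2 * exp (-n / 100) := by
          gcongr
          linarith [add_one_le_exp (2 : ℝ)]
      _ ≤ _ := by
          rw [← exp_add]
          refine exp_le_exp.2 ?_
          nlinarith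
  have hsplit : q * (M ^ 2 * (1 / 2 ^ ℓ + 64 * n / √(q ^ (n / 10)))) =
      q * (M ^ 2 * (1 / 2 ^ ℓ)) + q * (M ^ 2 * (64 * n / √(q ^ (n / 10)))) := by ring
  rw [hsplit]
  linarith

end Parameters

section Words

/-- The word `w` in the first two letters followed by the third letter, raised to the power `m`. -/
def powerWord (m : ℕ) (w : List Bool) : FreeGroup (Fin 3) :=
  (wordEval (fun i : Bool => FreeGroup.of (if i then 1 else 0)) w * FreeGroup.of 2) ^ m

theorem norm_wordEval_of_le {α : Type*} [DecidableEq α] (f : Bool → α) (w : List Bool) :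
    (wordEval (fun i => FreeGroup.of (f i)) w).norm ≤ w.length := by
  induction w with
  | nil => simp [wordEval]
  | cons s w ih =>
    rw [wordEval, List.length_cons]
    refine (FreeGroup.norm_mul_le _ _).trans ?_
    rw [FreeGroup.norm_of]
    omega

theorem norm_pow_le {α : Type*} [DecidableEq α] (g : FreeGroup α) (m : ℕ) :
    (g ^ m).norm ≤ m * g.norm := by
  induction m with
  | zero => simp
  | succ m ih =>
    rw [pow_succ, add_mul, one_mul]
    exact (FreeGroup.norm_mul_le _ _).trans (by omega)

theorem norm_powerWord_le (m : ℕ) (w : List Bool) :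
    (powerWord m w).norm ≤ m * (w.length + 1) := by
  refine (norm_pow_le _ _).trans (Nat.mul_le_mul_left _ ((FreeGroup.norm_mul_le _ _).trans ?_))
  rw [FreeGroup.norm_of]
  exact Nat.add_le_add_right (norm_wordEval_of_le _ w) 1

theorem lift_powerWord {Γ : Type*} [Group Γ] (x y z : Γ) (m : ℕ) (w : List Bool) :
    FreeGroup.lift ![x, y, z] (powerWord m w) =
      (wordEval (fun i : Bool => if i then y else x) w * z) ^ m := by
  rw [powerWord, map_pow, map_mul, map_wordEval, FreeGroup.lift_apply_of]
  congr 3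
  funext i
  cases i <;> simp

theorem isTransvection_of_powIsRankOne {F : Type} [Field F] [Fintype F] {n d : ℕ}
    {g : GL (Fin n) F} (hg : PowIsRankOne (Fintype.card F ^ d - 1) (glEquiv F n g)) :
    IsTransvection ((g ^ (Fintype.card F ^ d - 1) : GL (Fin n) F) : Matrix (Fin n) (Fin n) F) := by
  constructor
  · have h1 : Fintype.card F - 1 ∣ Fintype.card F ^ d - 1 := by
      simpa using Nat.sub_dvd_pow_sub_pow (Fintype.card F) 1 d
    obtain ⟨r, hr⟩ := h1
    have h2 : (g : Matrix (Fin n) (Fin n) F).det ≠ 0 := by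
      simpa using (Matrix.GeneralLinearGroup.det g).ne_zero
    rw [hr, Units.val_pow_eq_pow_val, Matrix.det_pow, pow_mul,
      FiniteField.pow_card_sub_one_eq_one _ h2, one_pow]
  · rw [← finrank_range_glEquiv_sub_id, map_pow]
    exact hg

theorem isTransvection_lift_powerWord {F : Type} [Field F] [Fintype F] {n d : ℕ}
    {G : Subgroup (GL (Fin n) F)} {x y z : G} {w : List Bool}
    (h : PowIsRankOne (Fintype.card F ^ d - 1)
      (wordEval (fun i : Bool => glEquiv F n ((if i then y else x : G) : GL (Fin n) F)) w *
        glEquiv F n (z : GL (Fin n) F))) :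
    IsTransvection (((FreeGroup.lift ![x, y, z] (powerWord (Fintype.card F ^ d - 1) w) : G) :
      GL (Fin n) F) : Matrix (Fin n) (Fin n) F) := by
  rw [lift_powerWord, Subgroup.coe_pow]
  refine isTransvection_of_powIsRankOne ?_
  convert h using 1
  rw [Subgroup.coe_mul, map_mul]
  congr 1
  exact map_wordEval ((glEquiv F n).toMonoidHom.comp G.subtype) _ w

end Words

/-- The explicit form of the main theorem: with `log q < n / (10 ^ 10 (log n) ^ 2)`, all but a
proportion `exp (-n / 10 ^ 10)` of the triples in `G` have a word of length at most
`n ^ (1605 log q)` whose value is a transvection. -/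
theorem one_sub_exp_le_proportion_transvection_word {F : Type} [Field F] [Fintype F] {n : ℕ}
    (hn : 2 ≤ n) (h : Real.log (Fintype.card F) < 1 / 10 ^ 10 * n / Real.log n ^ 2)
    (G : Subgroup (GL (Fin n) F))
    (hG : ∀ A : Matrix.SpecialLinearGroup (Fin n) F, Matrix.SpecialLinearGroup.toGL A ∈ G) :
    (1 : ℝ) - Real.exp (-(1 / 10 ^ 10) * n) ≤
      (Nat.card {t : G × G × G // ∃ w : FreeGroup (Fin 3),
        (w.norm : ℝ) ≤ (n : ℝ) ^ (1605 * Real.log (Fintype.card F)) ∧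
          IsTransvection (((FreeGroup.lift ![t.1, t.2.1, t.2.2] w : G) : GL (Fin n) F) :
            Matrix (Fin n) (Fin n) F)} : ℝ) / (Nat.card G : ℝ) ^ 3 := by
  classical
  have hq : 2 ≤ Fintype.card F := Fintype.one_lt_card
  obtain ⟨d, k, s, hs, hd, hnk, hcard, hlen, hM⟩ := exists_parameters hq hn h
  have hn9 := (log_estimates hq hn h).2.2.2.2.2
  have hn10 : 10 ≤ n := by
    have : (10 : ℝ) ≤ n := le_trans (by norm_num) hn9
    exact_mod_cast this
  set m := Fintype.card F ^ d - 1 with hm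
  set M : ℝ := (Fintype.card F : ℝ) ^ (s * s) * (2 * (d * k)) ^ k with hMdef
  have hM0 : 0 ≤ M := by positivity
  let H : Subgroup ((Fin n → F) ≃ₗ[F] (Fin n → F)) := G.map (glEquiv F n).toMonoidHom
  let φ : G ≃* H := (glEquiv F n).subgroupMap G
  have hfr : finrank F (Fin n → F) = n := by simp
  have : Finite ((Fin n → F) ≃ₗ[F] (Fin n → F)) := Finite.of_equiv _ (glEquiv F n).toEquiv
  have := Fintype.ofFinite ((Fin n → F) ≃ₗ[F] (Fin n → F))
  have := Fintype.ofFinite H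
  have := Fintype.ofFinite G
  have hH : ∀ g : (Fin n → F) ≃ₗ[F] (Fin n → F), LinearEquiv.det g = 1 → g ∈ H := by
    intro g hg
    refine ⟨(glEquiv F n).symm g, ?_, (glEquiv F n).apply_symm_apply g⟩
    rw [← (glEquiv F n).apply_symm_apply g, det_glEquiv] at hg
    have h1 : (((glEquiv F n).symm g : GL (Fin n) F) : Matrix (Fin n) (Fin n) F).det = 1 := by
      simpa using congrArg Units.val hg
    have h2 : Matrix.SpecialLinearGroup.toGL ⟨_, h1⟩ = (glEquiv F n).symm g := Units.ext rfl
    exact h2 ▸ hG ⟨_, h1⟩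
  have hroots : ∀ δ : Fˣ, (Fintype.card ((Fin n → F) ≃ₗ[F] (Fin n → F)) : ℝ) ≤
      M * Nat.card (transvectionRoots (Fin n → F) m δ) := by
    intro δ
    have := card_le_mul_card_transvectionRoots (V := Fin n → F) hs hd (hfr.trans hnk) hcard δ
    rw [Nat.card_eq_fintype_card] at this
    rw [hMdef]
    exact_mod_cast this
  have hbad := card_forall_word_not_powIsRankOne_le hH (ℓ := n / 32) (b := n / 10) (e := n / 2)
    hroots (by omega) (by omega) (by omega) (by omega)
  rw [hfr] at hbad
  have hbound := failure_bound_le hq hn h hM0 hM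
  have hcardH : Fintype.card H = Fintype.card G := (Fintype.card_congr φ.toEquiv).symm
  rw [hcardH] at hbad
  let P : G × G × G → Prop := fun t => ∃ w : FreeGroup (Fin 3),
    (w.norm : ℝ) ≤ (n : ℝ) ^ (1605 * Real.log (Fintype.card F)) ∧
      IsTransvection (((FreeGroup.lift ![t.1, t.2.1, t.2.2] w : G) : GL (Fin n) F) :
        Matrix (Fin n) (Fin n) F)
  have hinj : (Finset.univ.filter fun t : G × G × G => ¬ P t).card ≤
      (Finset.univ.filter fun p : (Bool → H) × H => ∀ w : Fin (n / 32) → Bool,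
        ¬ PowIsRankOne m (wordEval (fun i => (p.1 i : (Fin n → F) ≃ₗ[F] (Fin n → F)))
          (List.ofFn w) * (p.2 : (Fin n → F) ≃ₗ[F] (Fin n → F)))).card := by
    refine Finset.card_le_card_of_injOn
      (fun t => (fun i : Bool => φ (if i then t.2.1 else t.1), φ t.2.2)) ?_ ?_
    · intro t ht
      refine Finset.mem_coe.2 (Finset.mem_filter.2 ⟨Finset.mem_univ _, fun w hw => ?_⟩)
      refine (Finset.mem_filter.1 (Finset.mem_coe.1 ht)).2
        ⟨powerWord m (List.ofFn w), le_trans ?_ hlen, isTransvection_lift_powerWord hw⟩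
      have := norm_powerWord_le m (List.ofFn w)
      rw [List.length_ofFn] at this
      exact_mod_cast this
    · rintro ⟨x, y, z⟩ _ ⟨x', y', z'⟩ _ h
      simp only [Prod.mk.injEq, EmbeddingLike.apply_eq_iff_eq] at h
      have h1 := congrFun h.1 false
      have h2 := congrFun h.1 true
      simp_all
  have hsum : ((Finset.univ.filter P).card : ℝ) +
      (Finset.univ.filter fun t : G × G × G => ¬ P t).card = (Fintype.card G : ℝ) ^ 3 := by
    have := Finset.card_filter_add_card_filter_not (s := (Finset.univ : Finset (G × G × G))) P
    rw [Finset.card_univ, Fintype.card_prod, Fintype.card_prod] at this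
    rw [← Nat.cast_add, this]
    push_cast
    ring
  have hG0 : (0 : ℝ) < (Fintype.card G : ℝ) ^ 3 := by
    have : 0 < Fintype.card G := Fintype.card_pos
    positivity
  have hgood : Nat.card {t : G × G × G // P t} = (Finset.univ.filter P).card := by
    rw [Nat.card_eq_fintype_card, Fintype.card_subtype]
  rw [Nat.card_eq_fintype_card (α := G), le_div_iff₀ hG0]
  change _ ≤ (Nat.card {t : G × G × G // P t} : ℝ)
  rw [hgood]
  have hinj' : ((Finset.univ.filter fun t : G × G × G => ¬ P t).card : ℝ) ≤
      Real.exp (-(1 / 10 ^ 10) * n) * (Fintype.card G : ℝ) ^ 3 :=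
    (Nat.cast_le.2 hinj).trans (hbad.trans (mul_le_mul_of_nonneg_right hbound hG0.le))
  linarith

end TransvectionWords

/-- **Finding a transvection as a short word in 3 random generators**
(linear case of Theorem 1.1). There are absolute constants `c, C > 0` such that
for every finite field `F_q`, every `n ≥ 2` with `log q < c·n/(log n)²` and every
group `G` with `SL_n(q) ≤ G ≤ GL_n(q)`: for uniformly random `x, y, z ∈ G`, with
probability at least `1 - e^{-c·n}` there is a word `w ∈ F_3` of reduced length at
most `n^{C·log q}` with `w(x,y,z)` a transvection. -/
theorem stmt1 :
    ∃ c C : ℝ, 0 < c ∧ 0 < C ∧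
      ∀ (F : Type) [Field F] [Fintype F] (n : ℕ), 2 ≤ n →
        Real.log (Fintype.card F) < c * n / (Real.log n) ^ 2 →
        ∀ G : Subgroup (GL (Fin n) F),
          (∀ A : Matrix.SpecialLinearGroup (Fin n) F,
              Matrix.SpecialLinearGroup.toGL A ∈ G) →
          (1 : ℝ) - Real.exp (-c * n) ≤
            (Nat.card {t : ↥G × ↥G × ↥G //
                ∃ w : FreeGroup (Fin 3),
                  (w.norm : ℝ) ≤ (n : ℝ) ^ (C * Real.log (Fintype.card F)) ∧
                  IsTransvection
                    (((FreeGroup.lift ![t.1, t.2.1, t.2.2] w : ↥G) :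
                        GL (Fin n) F) : Matrix (Fin n) (Fin n) F)} : ℝ) /
              (Nat.card ↥G : ℝ) ^ 3 := by
  exact ⟨1 / 10 ^ 10, 1605, by positivity, by positivity, fun F _ _ n hn h G hG =>
    TransvectionWords.one_sub_exp_le_proportion_transvection_word hn h G hG⟩
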